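/- There exists a dense G_δ subset M of ℝ such that for every μ ∈ M and every θ ∈ ℝ, the Hausdorff dimension of σ(H_{μ,θ}), viewed as a subset of ℝ, equals 0. -/

import Mathlib

open Real MeasureTheory

namespace AlmostMathieu

/-- The product of the matrices `!![x j, -s; s, 0]` for `j = k - 1, …, 0`. For `s = 1` these are the
transfer matrices of the recursion `u (j + 2) = x j * u (j + 1) - u j`. -/
def transfer {R : Type*} [CommRing R] (s : R) (x : ℕ → R) : ℕ → Matrix (Fin 2) (Fin 2) R
  | 0 => 1
  | k + 1 => !![x k, -s; s, 0] * transfer s x k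

section Ring

variable {R S : Type*} [CommRing R] [CommRing S]

theorem transfer_map (f : R →+* S) (s : R) (x : ℕ → R) (k : ℕ) :
    (transfer s x k).map f = transfer (f s) (fun j => f (x j)) k := by
  induction k with
  | zero => simp [transfer, Matrix.map_one]
  | succ k ih =>
    rw [transfer, transfer, Matrix.map_mul, ih]
    congr 1
    ext i j
    fin_cases i <;> fin_cases j <;> simp

theorem trace_transfer_map (f : R →+* S) (s : R) (x : ℕ → R) (k : ℕ) :
    f (transfer s x k).trace = (transfer (f s) (fun j => f (x j)) k).trace := by
  simp [← transfer_map, Matrix.trace]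

theorem transfer_smul (c s : R) (x : ℕ → R) (k : ℕ) :
    transfer (c * s) (fun j => c * x j) k = c ^ k • transfer s x k := by
  induction k with
  | zero => simp [transfer]
  | succ k ih =>
    have h : !![c * x k, -(c * s); c * s, 0] = c • !![x k, -s; s, 0] := by
      ext i j
      fin_cases i <;> fin_cases j <;> simp
    rw [transfer, transfer, ih, h, Matrix.smul_mul, Matrix.mul_smul, smul_smul, pow_succ, mul_comm]

theorem transfer_succ_shift (s : R) (x : ℕ → R) (k : ℕ) :
    transfer s x (k + 1) = transfer s (fun j => x (j + 1)) k * !![x 0, -s; s, 0] := by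
  induction k with
  | zero => simp [transfer]
  | succ k ih => rw [transfer, ih, ← mul_assoc]; rfl

theorem trace_transfer_shift (s : R) (x : ℕ → R) (k : ℕ) (hx : x k = x 0) :
    (transfer s (fun j => x (j + 1)) k).trace = (transfer s x k).trace := by
  cases k with
  | zero => simp [transfer]
  | succ k => rw [transfer, transfer_succ_shift s x, Matrix.trace_mul_comm, hx]

theorem det_transfer (x : ℕ → R) (k : ℕ) : (transfer 1 x k).det = 1 := by
  induction k with
  | zero => simp [transfer]
  | succ k ih => rw [transfer, Matrix.det_mul, ih]; simp [Matrix.det_fin_two]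

theorem transfer_succ_entries (s : R) (x : ℕ → R) (k : ℕ) (j : Fin 2) :
    transfer s x (k + 1) 0 j = x k * transfer s x k 0 j - s * transfer s x k 1 j ∧
      transfer s x (k + 1) 1 j = s * transfer s x k 0 j := by
  constructor
  · simp [transfer, Matrix.mul_apply, Fin.sum_univ_two]
    ring
  · simp [transfer, Matrix.mul_apply, Fin.sum_univ_two]

end Ring

open Polynomial in
/-- The symbol `z (E - ω ^ j z - ω ^ (-j) z⁻¹)`, a polynomial in `z`. -/
noncomputable def symbol (ω E : ℂ) (j : ℕ) : ℂ[X] :=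
  C E * X - C (ω ^ j) * X ^ 2 - C (ω ^ j)⁻¹

section Chambers

open Polynomial

theorem natDegree_symbol_le (ω E : ℂ) (j : ℕ) : (symbol ω E j).natDegree ≤ 2 := by
  unfold symbol; compute_degree

theorem natDegree_transfer_symbol_le (ω E : ℂ) (k : ℕ) (i j : Fin 2) :
    (transfer X (symbol ω E) k i j).natDegree ≤ 2 * k := by
  induction k generalizing i with
  | zero => fin_cases i <;> fin_cases j <;> simp [transfer]
  | succ k ih =>
    obtain ⟨h0, h1⟩ := transfer_succ_entries X (symbol ω E) k j
    have hX (i : Fin 2) : (X * transfer X (symbol ω E) k i j).natDegree ≤ 2 * (k + 1) := by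
      refine natDegree_mul_le.trans ?_
      have := ih i
      rw [natDegree_X]
      omega
    fin_cases i
    · simp only [Fin.zero_eta, h0]
      refine (natDegree_sub_le _ _).trans (max_le ?_ (hX 1))
      refine natDegree_mul_le.trans ?_
      have := ih 0
      have := natDegree_symbol_le ω E k
      omega
    · simp only [Fin.mk_one, h1]
      exact hX 0

theorem coeff_transfer_symbol_zero_zero (ω E : ℂ) (k : ℕ) :
    (transfer X (symbol ω E) k 0 0).coeff (2 * k) = ∏ j ∈ Finset.range k, -ω ^ j := by
  induction k with
  | zero => simp [transfer]
  | succ k ih =>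
    have hd (i : Fin 2) : (transfer X (symbol ω E) k i 0).coeff (2 * k + 1) = 0 :=
      coeff_eq_zero_of_natDegree_lt
        ((natDegree_transfer_symbol_le ω E k i 0).trans_lt (Nat.lt_succ_self _))
    have hd' : (transfer X (symbol ω E) k 0 0).coeff (2 * k + 2) = 0 :=
      coeff_eq_zero_of_natDegree_lt
        ((natDegree_transfer_symbol_le ω E k 0 0).trans_lt (by omega))
    rw [(transfer_succ_entries X (symbol ω E) k 0).1, Finset.prod_range_succ, ← ih, symbol]
    rw [show 2 * (k + 1) = 2 * k + 2 by ring]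
    simp only [sub_mul, mul_assoc, coeff_sub, coeff_C_mul, coeff_X_mul, coeff_X_pow_mul, hd, hd']
    ring

theorem coeff_transfer_symbol_one_one (ω E : ℂ) {k : ℕ} (hk : 0 < k) :
    (transfer X (symbol ω E) k 1 1).coeff (2 * k) = 0 := by
  obtain ⟨k, rfl⟩ := Nat.exists_eq_succ_of_ne_zero hk.ne'
  rw [(transfer_succ_entries X (symbol ω E) k 1).2, show 2 * k.succ = 2 * k + 1 + 1 by omega,
    coeff_X_mul]
  exact coeff_eq_zero_of_natDegree_lt
    ((natDegree_transfer_symbol_le ω E k 0 1).trans_lt (Nat.lt_succ_self _))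

theorem prod_neg_pow_eq_neg_one {ω : ℂ} {q : ℕ} (hω : IsPrimitiveRoot ω q) (hq : 0 < q) :
    ∏ j ∈ Finset.range q, -ω ^ j = -1 := by
  have h := congrArg (eval 0) (X_pow_sub_C_eq_prod hω hq (one_pow q))
  simpa [eval_prod, hq.ne'] using h.symm

theorem coeff_zero_trace_transfer_symbol {ω : ℂ} {q : ℕ} (hω : IsPrimitiveRoot ω q) (hq : 0 < q)
    (E : ℂ) : (transfer X (symbol ω E) q).trace.coeff 0 = -1 := by
  have key (k : ℕ) (hk : 0 < k) : (transfer X (symbol ω E) k 0 0).coeff 0 =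
      ∏ j ∈ Finset.range k, -ω⁻¹ ^ j ∧ (transfer X (symbol ω E) k 1 1).coeff 0 = 0 := by
    refine ⟨?_, ?_⟩
    · clear hk
      induction k with
      | zero => simp [transfer]
      | succ k ih =>
        rw [(transfer_succ_entries X (symbol ω E) k 0).1, Finset.prod_range_succ, ← ih, symbol]
        simp [mul_coeff_zero]
        ring
    · obtain ⟨k, rfl⟩ := Nat.exists_eq_succ_of_ne_zero hk.ne'
      rw [(transfer_succ_entries X (symbol ω E) k 1).2]
      simp [mul_coeff_zero]
  rw [Matrix.trace_fin_two, coeff_add, (key q hq).1, (key q hq).2,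
    prod_neg_pow_eq_neg_one hω.inv hq, add_zero]

theorem coeff_top_trace_transfer_symbol {ω : ℂ} {q : ℕ} (hω : IsPrimitiveRoot ω q) (hq : 0 < q)
    (E : ℂ) : (transfer X (symbol ω E) q).trace.coeff (2 * q) = -1 := by
  rw [Matrix.trace_fin_two, coeff_add, coeff_transfer_symbol_zero_zero,
    coeff_transfer_symbol_one_one ω E hq, prod_neg_pow_eq_neg_one hω hq, add_zero]

theorem coeff_trace_transfer_symbol_eq_zero {ω : ℂ} {q : ℕ} (hω : IsPrimitiveRoot ω q) (hq : 0 < q)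
    (E : ℂ) {n : ℕ} (hn : ¬ q ∣ n) : (transfer X (symbol ω E) q).trace.coeff n = 0 := by
  have hω0 : ω ≠ 0 := hω.ne_zero hq.ne'
  have hper : symbol ω E q = symbol ω E 0 := by simp [symbol, hω.pow_eq_one]
  let f : ℂ[X] →+* ℂ[X] := compRingHom (C ω * X)
  have hf (p : ℂ[X]) : f p = p.comp (C ω * X) := rfl
  have hsymb (j : ℕ) : f (symbol ω E j) = C ω * symbol ω E (j + 1) := by
    rw [hf]
    simp only [symbol, sub_comp, mul_comp, C_comp, X_comp, pow_comp]
    have : C (ω ^ j)⁻¹ = C ω * C (ω ^ (j + 1))⁻¹ := by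
      rw [← C_mul]
      congr 1
      field_simp
      ring
    rw [this, pow_succ ω, C_mul]
    ring
  have hcomp : f (transfer X (symbol ω E) q).trace = (transfer X (symbol ω E) q).trace := by
    rw [trace_transfer_map]
    simp only [hsymb]
    rw [hf, X_comp, transfer_smul, ← C_pow, hω.pow_eq_one, C_1, one_smul,
      trace_transfer_shift X (symbol ω E) q hper]
  have h := congrArg (coeff · n) hcomp
  simp only [hf, comp_C_mul_X_coeff] at h
  by_contra h0
  exact hn ((hω.pow_eq_one_iff_dvd n).1 (mul_left_cancel₀ h0 (h.trans (mul_one _).symm)))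

/-- Chambers' formula in polynomial form. -/
theorem trace_transfer_symbol {ω : ℂ} {q : ℕ} (hω : IsPrimitiveRoot ω q) (hq : 0 < q) (E : ℂ) :
    (transfer X (symbol ω E) q).trace =
      C ((transfer X (symbol ω E) q).trace.coeff q) * X ^ q - 1 - X ^ (2 * q) := by
  ext n
  simp only [coeff_sub, coeff_C_mul, coeff_X_pow, coeff_one]
  by_cases hn : q ∣ n
  · obtain ⟨m, rfl⟩ := hn
    rcases m with _ | _ | _ | m
    · simp [coeff_zero_trace_transfer_symbol hω hq, hq.ne, hq.ne']
    · simp [hq.ne', show q ≠ 2 * q by omega]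
    · have := coeff_top_trace_transfer_symbol hω hq E
      simp [mul_comm q 2, this, hq.ne']
    · have h1 : q * (m + 1 + 1 + 1) ≠ q := by nlinarith
      have h2 : q * (m + 1 + 1 + 1) ≠ 2 * q := by nlinarith
      have h3 : q * (m + 1 + 1 + 1) ≠ 0 := by positivity
      rw [if_neg h1, if_neg h2, if_neg h3]
      have : (transfer X (symbol ω E) q).trace.natDegree < q * (m + 1 + 1 + 1) := by
        rw [Matrix.trace_fin_two]
        refine (natDegree_add_le_of_degree_le (natDegree_transfer_symbol_le ω E q 0 0)
          (natDegree_transfer_symbol_le ω E q 1 1)).trans_lt ?_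
        nlinarith
      simp [coeff_eq_zero_of_natDegree_lt this]
  · rw [coeff_trace_transfer_symbol_eq_zero hω hq E hn, if_neg, if_neg, if_neg]
    · simp
    all_goals rintro rfl; exact hn (by simp)

end Chambers

/-- The coefficients `E - 2 Re (z ω ^ j)` of the eigenvalue equation. -/
noncomputable def coef (ω z : ℂ) (E : ℝ) (j : ℕ) : ℝ := E - 2 * (z * ω ^ j).re

/-- The phase-independent part of the discriminant of the periodic operator. -/
noncomputable def chambers (ω : ℂ) (q : ℕ) (E : ℝ) : ℝ := (transfer 1 (coef ω 1 E) q).trace + 2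

theorem two_mul_re_of_norm_eq_one {z : ℂ} (hz : ‖z‖ = 1) : ((2 * z.re : ℝ) : ℂ) = z + z⁻¹ := by
  rw [Complex.inv_eq_conj hz, Complex.add_conj]

theorem trace_transfer_coef {ω : ℂ} {q : ℕ} (hω : IsPrimitiveRoot ω q) (hq : 0 < q) {z : ℂ}
    (hz : ‖z‖ = 1) (E : ℝ) :
    (transfer 1 (coef ω z E) q).trace = chambers ω q E - 2 * (z ^ q).re := by
  have hω1 : ‖ω‖ = 1 := hω.norm'_eq_one hq.ne'
  set c := (transfer Polynomial.X (symbol ω E) q).trace.coeff q with hc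
  have key (z : ℂ) (hz : ‖z‖ = 1) :
      (((transfer 1 (coef ω z E) q).trace : ℝ) : ℂ) = c - ((2 * (z ^ q).re : ℝ) : ℂ) := by
    have hz0 : z ≠ 0 := by rintro rfl; simp at hz
    have hω0 : ω ≠ 0 := hω.ne_zero hq.ne'
    have h := congrArg (Polynomial.evalRingHom z) (trace_transfer_symbol hω hq (E : ℂ))
    rw [trace_transfer_map, ← hc] at h
    have hx : (fun j => Polynomial.evalRingHom z (symbol ω E j)) =
        fun j => z * Complex.ofRealHom (coef ω z E j) := by
      ext j
      have := two_mul_re_of_norm_eq_one (z := z * ω ^ j) (by simp [hz, hω1])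
      simp only [coef, Complex.ofRealHom_eq_coe, Complex.ofReal_sub, this, symbol]
      simp
      field_simp
      ring
    have hs : Polynomial.evalRingHom z Polynomial.X = z * Complex.ofRealHom 1 := by simp
    rw [hx, hs, transfer_smul, Matrix.trace_smul, ← trace_transfer_map] at h
    rw [two_mul_re_of_norm_eq_one (z := z ^ q) (by simp [hz])]
    have hzq : z ^ q ≠ 0 := pow_ne_zero _ hz0
    refine mul_left_cancel₀ hzq ?_
    simp only [smul_eq_mul, Complex.ofRealHom_eq_coe] at h
    rw [h]
    simp
    field_simp
    ring
  have h1 := key 1 (by simp)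
  have hz' := key z hz
  have : (((transfer 1 (coef ω z E) q).trace : ℝ) : ℂ) =
      ((chambers ω q E - 2 * (z ^ q).re : ℝ) : ℂ) := by
    rw [chambers, hz', Complex.ofReal_sub, Complex.ofReal_add, h1]
    simp
  exact_mod_cast this

/-- The defect of `ψ` as a solution of `ψ (j + 2) = x j * ψ (j + 1) - ψ j`. -/
def defect (x : ℕ → ℝ) (ψ : ℕ → ℂ) (j : ℕ) : ℂ := ψ (j + 2) + ψ j - x j * ψ (j + 1)

section Transfer

variable {x : ℕ → ℝ} {B : ℝ}

theorem abs_transfer_le (hB : 0 ≤ B) (hx : ∀ j, |x j| ≤ B) (k : ℕ) (i j : Fin 2) :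
    |transfer 1 x k i j| ≤ (B + 1) ^ k := by
  induction k generalizing i with
  | zero => fin_cases i <;> fin_cases j <;> simp [transfer]
  | succ k ih =>
    obtain ⟨h0, h1⟩ := transfer_succ_entries 1 x k j
    have hp : 0 ≤ (B + 1) ^ k := by positivity
    have hx' := mul_le_mul (hx k) (ih 0) (abs_nonneg _) hB
    fin_cases i
    · simp only [Fin.zero_eta, h0, one_mul]
      refine (abs_sub _ _).trans ?_
      rw [abs_mul, pow_succ]
      linarith [ih 1]
    · simp only [Fin.mk_one, h1, one_mul]
      refine (ih 0).trans ?_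
      rw [pow_succ]
      nlinarith

theorem norm_sub_transfer_le (hB : 0 ≤ B) (hx : ∀ j, |x j| ≤ B) (ψ : ℕ → ℂ) (k : ℕ) :
    ‖ψ (k + 1) - (transfer 1 x k 0 0 * ψ 1 + transfer 1 x k 0 1 * ψ 0)‖ ≤
        (B + 1) ^ k * ∑ j ∈ Finset.range k, ‖defect x ψ j‖ ∧
      ‖ψ k - (transfer 1 x k 1 0 * ψ 1 + transfer 1 x k 1 1 * ψ 0)‖ ≤
        (B + 1) ^ k * ∑ j ∈ Finset.range k, ‖defect x ψ j‖ := by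
  induction k with
  | zero => simp [transfer]
  | succ k ih =>
    obtain ⟨ih0, ih1⟩ := ih
    obtain ⟨h00, h10⟩ := transfer_succ_entries 1 x k 0
    obtain ⟨h01, h11⟩ := transfer_succ_entries 1 x k 1
    rw [h00, h10, h01, h11, Finset.sum_range_succ, pow_succ]
    set e0 := ψ (k + 1) - (transfer 1 x k 0 0 * ψ 1 + transfer 1 x k 0 1 * ψ 0) with he0
    set e1 := ψ k - (transfer 1 x k 1 0 * ψ 1 + transfer 1 x k 1 1 * ψ 0) with he1
    set s := ∑ j ∈ Finset.range k, ‖defect x ψ j‖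
    have hs : 0 ≤ s := Finset.sum_nonneg fun _ _ => norm_nonneg _
    have hp : 1 ≤ (B + 1) ^ k := one_le_pow₀ (by linarith)
    have hd := norm_nonneg (defect x ψ k)
    have hps : 0 ≤ (B + 1) ^ k * s := by positivity
    have hpd : ‖defect x ψ k‖ ≤ (B + 1) ^ k * ‖defect x ψ k‖ := by nlinarith
    have hBd : 0 ≤ B * ((B + 1) ^ k * ‖defect x ψ k‖) := by positivity
    have hBs : 0 ≤ B * ((B + 1) ^ k * s) := by positivity
    constructor
    · have : ψ (k + 1 + 1) - (((x k * transfer 1 x k 0 0 - 1 * transfer 1 x k 1 0 : ℝ) : ℂ) * ψ 1 +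
          ((x k * transfer 1 x k 0 1 - 1 * transfer 1 x k 1 1 : ℝ) : ℂ) * ψ 0) =
          x k * e0 - e1 + defect x ψ k := by
        rw [he0, he1, defect]
        push_cast
        ring
      rw [this]
      refine (norm_add_le _ _).trans ?_
      have h1 := norm_sub_le (x k * e0) e1
      rw [norm_mul, Complex.norm_real, Real.norm_eq_abs] at h1
      have h2 := mul_le_mul (hx k) ih0 (norm_nonneg _) hB
      nlinarith
    · simp only [one_mul]
      refine ih0.trans ?_
      nlinarith

theorem three_term_le (hB : 0 ≤ B) (hx : ∀ j, |x j| ≤ B) (ψ : ℕ → ℂ) (k : ℕ) {κ : ℝ}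
    (hκ : ∀ i j, |transfer 1 (fun n => x (n + k)) k i j - transfer 1 x k i j| ≤ κ) :
    ‖ψ (2 * k + 1) + ψ 1 - (transfer 1 (fun n => x (n + k)) k).trace * ψ (k + 1)‖ ≤
        κ * (‖ψ (k + 1)‖ + ‖ψ k‖) +
          2 * ((B + 1) ^ k) ^ 2 * ∑ j ∈ Finset.range (2 * k), ‖defect x ψ j‖ ∧
      ‖ψ (2 * k) + ψ 0 - (transfer 1 (fun n => x (n + k)) k).trace * ψ k‖ ≤
        κ * (‖ψ (k + 1)‖ + ‖ψ k‖) +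
          2 * ((B + 1) ^ k) ^ 2 * ∑ j ∈ Finset.range (2 * k), ‖defect x ψ j‖ := by
  obtain ⟨h0', h1'⟩ := norm_sub_transfer_le hB hx ψ k
  obtain ⟨h0, h1⟩ := norm_sub_transfer_le hB (fun j => hx (j + k)) (fun n => ψ (n + k)) k
  have hsum : ∑ j ∈ Finset.range (2 * k), ‖defect x ψ j‖ =
      ∑ j ∈ Finset.range k, ‖defect x ψ j‖ +
        ∑ j ∈ Finset.range k, ‖defect (fun n => x (n + k)) (fun n => ψ (n + k)) j‖ := by
    rw [two_mul, Finset.sum_range_add]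
    congr 1
    refine Finset.sum_congr rfl fun j _ => ?_
    simp only [defect]
    rw [show j + 2 + k = k + j + 2 by ring, show j + 1 + k = k + j + 1 by ring, add_comm j k]
  rw [hsum]
  set s' := ∑ j ∈ Finset.range k, ‖defect x ψ j‖
  set s := ∑ j ∈ Finset.range k, ‖defect (fun n => x (n + k)) (fun n => ψ (n + k)) j‖
  have hs' : 0 ≤ s' := Finset.sum_nonneg fun _ _ => norm_nonneg _
  have hs : 0 ≤ s := Finset.sum_nonneg fun _ _ => norm_nonneg _
  have hb := abs_transfer_le hB hx k
  have hdet' : ((transfer 1 x k 0 0 * transfer 1 x k 1 1 -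
      transfer 1 x k 0 1 * transfer 1 x k 1 0 : ℝ) : ℂ) = 1 := by
    rw [← Matrix.det_fin_two, det_transfer, Complex.ofReal_one]
  push_cast at hdet'
  have hc : 1 ≤ (B + 1) ^ k := one_le_pow₀ (by linarith)
  set c := (B + 1) ^ k
  set T := transfer 1 (fun n => x (n + k)) k
  set T' := transfer 1 x k
  set e0' := ψ (k + 1) - (T' 0 0 * ψ 1 + T' 0 1 * ψ 0) with he0'
  set e1' := ψ k - (T' 1 0 * ψ 1 + T' 1 1 * ψ 0) with he1'
  rw [show k + 1 + k = 2 * k + 1 by ring, add_comm 1 k, zero_add] at h0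
  rw [show k + k = 2 * k by ring, add_comm 1 k, zero_add] at h1
  set e0 := ψ (2 * k + 1) - (T 0 0 * ψ (k + 1) + T 0 1 * ψ k) with he0
  set e1 := ψ (2 * k) - (T 1 0 * ψ (k + 1) + T 1 1 * ψ k) with he1
  have bound (a b p r : ℝ) (e : ℂ) (ha : |a| ≤ κ) (hb : |b| ≤ κ) (hp : |p| ≤ c) (hr : |r| ≤ c)
      (he : ‖e‖ ≤ c * s) :
      ‖a * ψ (k + 1) + b * ψ k + e + p * e0' + r * e1'‖ ≤
        κ * (‖ψ (k + 1)‖ + ‖ψ k‖) + 2 * c ^ 2 * (s' + s) := by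
    have h := norm_add_le (a * ψ (k + 1) + b * ψ k + e + p * e0') (r * e1')
    have h' := norm_add₄_le (a := a * ψ (k + 1)) (b := b * ψ k) (c := e) (d := p * e0')
    simp only [norm_mul, Complex.norm_real, Real.norm_eq_abs] at h h'
    have ha' := mul_le_mul_of_nonneg_right ha (norm_nonneg (ψ (k + 1)))
    have hb' := mul_le_mul_of_nonneg_right hb (norm_nonneg (ψ k))
    have hp' := mul_le_mul hp h0' (norm_nonneg _) (by linarith)
    have hr' := mul_le_mul hr h1' (norm_nonneg _) (by linarith)
    have hcs : c * s ≤ c * (c * s) := le_mul_of_one_le_left (by positivity) hc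
    have : 0 ≤ c ^ 2 * s := by positivity
    linarith
  rw [Matrix.trace_fin_two]
  constructor
  · have : ψ (2 * k + 1) + ψ 1 - ((T 0 0 + T 1 1 : ℝ) : ℂ) * ψ (k + 1) =
        ((T' 1 1 - T 1 1 : ℝ) : ℂ) * ψ (k + 1) + ((T 0 1 - T' 0 1 : ℝ) : ℂ) * ψ k + e0 +
          ((-T' 1 1 : ℝ) : ℂ) * e0' + T' 0 1 * e1' := by
      rw [he0, he0', he1']
      push_cast
      linear_combination (-ψ 1) * hdet'
    rw [this]
    exact bound _ _ _ _ _ (by rw [abs_sub_comm]; exact hκ 1 1) (hκ 0 1)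
      (by rw [abs_neg]; exact hb 1 1) (hb 0 1) h0
  · have : ψ (2 * k) + ψ 0 - ((T 0 0 + T 1 1 : ℝ) : ℂ) * ψ k =
        ((T 1 0 - T' 1 0 : ℝ) : ℂ) * ψ (k + 1) + ((T' 0 0 - T 0 0 : ℝ) : ℂ) * ψ k + e1 +
          T' 1 0 * e0' + ((-T' 0 0 : ℝ) : ℂ) * e1' := by
      rw [he1, he0', he1']
      push_cast
      linear_combination (-ψ 0) * hdet'
    rw [this]
    exact bound _ _ _ _ _ (hκ 1 0) (by rw [abs_sub_comm]; exact hκ 0 0) (hb 1 0)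
      (by rw [abs_neg]; exact hb 0 0) h1

end Transfer

theorem abs_coef_le {ω z : ℂ} (hω : ‖ω‖ = 1) (hz : ‖z‖ = 1) {E : ℝ} (hE : |E| ≤ 5) (j : ℕ) :
    |coef ω z E j| ≤ 7 := by
  have h := Complex.abs_re_le_norm (z * ω ^ j)
  rw [norm_mul, norm_pow, hω, hz, one_pow, mul_one] at h
  rw [abs_le] at *
  unfold coef
  constructor <;> linarith

theorem coef_add (ω z : ℂ) (E : ℝ) (n k : ℕ) : coef ω z E (n + k) = coef ω (z * ω ^ k) E n := by
  simp only [coef]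
  ring_nf

theorem continuous_transfer_coef (k : ℕ) (i j : Fin 2) :
    Continuous fun p : ℂ × ℂ × ℝ => transfer 1 (coef p.1 p.2.1 p.2.2) k i j := by
  induction k generalizing i with
  | zero => exact continuous_const
  | succ k ih =>
    have hc : Continuous fun p : ℂ × ℂ × ℝ => coef p.1 p.2.1 p.2.2 k := by
      unfold coef
      fun_prop
    fin_cases i
    · simp only [Fin.zero_eta, (transfer_succ_entries (1 : ℝ) _ k j).1]
      exact (hc.mul (ih 0)).sub (continuous_const.mul (ih 1))
    · simp only [Fin.mk_one, (transfer_succ_entries (1 : ℝ) _ k j).2]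
      exact continuous_const.mul (ih 0)

theorem exists_hyperbolic_radius {ω₀ : ℂ} {q : ℕ} (hω₀ : IsPrimitiveRoot ω₀ q) (hq : 0 < q) {δ : ℝ}
    (hδ : 0 < δ) :
    ∃ r > 0, ∀ (ω z z' c : ℂ) (E : ℝ), ‖ω‖ = 1 → ‖z‖ = 1 → ‖z'‖ = 1 → ‖c‖ = 1 → |E| ≤ 5 →
      dist ω ω₀ < r → dist z c < r → dist z' c < r →
      2 + δ ≤ |chambers ω₀ q E - 2 * (c ^ q).re| →
      2 + δ / 2 ≤ |(transfer 1 (coef ω z E) q).trace| ∧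
        ∀ i j, |transfer 1 (coef ω z E) q i j - transfer 1 (coef ω z' E) q i j| ≤ δ / 16 := by
  let K : Set (ℂ × ℂ × ℝ) := Metric.sphere 0 1 ×ˢ Metric.sphere 0 1 ×ˢ Metric.closedBall 0 5
  have hK : IsCompact K :=
    (isCompact_sphere 0 1).prod ((isCompact_sphere 0 1).prod (isCompact_closedBall 0 5))
  let F : ℂ × ℂ × ℝ → Fin 2 → Fin 2 → ℝ := fun p i j => transfer 1 (coef p.1 p.2.1 p.2.2) q i j
  have hF : Continuous F :=
    continuous_pi fun i => continuous_pi fun j => continuous_transfer_coef q i j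
  obtain ⟨r, hr, h⟩ := Metric.uniformContinuousOn_iff.1
    (hK.uniformContinuousOn_of_continuous hF.continuousOn) (δ / 32) (by positivity)
  refine ⟨r, hr, fun ω z z' c E hω hz hz' hc hE hωr hzr hzr' htr => ?_⟩
  have key (z : ℂ) (hz : ‖z‖ = 1) (hzr : dist z c < r) (i j : Fin 2) :
      |transfer 1 (coef ω z E) q i j - transfer 1 (coef ω₀ c E) q i j| ≤ δ / 32 := by
    have h1 := h (ω, z, E) (by simp [K, hω, hz, hE]) (ω₀, c, E)
      (by simp [K, hω₀.norm'_eq_one hq.ne', hc, hE]) (by simp [Prod.dist_eq, hωr, hzr])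
    exact ((dist_le_pi_dist (F (ω, z, E) i) (F (ω₀, c, E) i) j).trans
      (dist_le_pi_dist _ _ i)).trans h1.le
  constructor
  · rw [← trace_transfer_coef hω₀ hq hc, Matrix.trace_fin_two] at htr
    rw [Matrix.trace_fin_two]
    have h0 := abs_le.1 (key z hz hzr 0 0)
    have h1 := abs_le.1 (key z hz hzr 1 1)
    rw [le_abs] at *
    rcases htr with htr | htr
    · left; linarith
    · right; linarith
  · intro i j
    have h0 := abs_le.1 (key z hz hzr i j)
    have h1 := abs_le.1 (key z' hz' hzr' i j)
    rw [abs_le]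
    constructor <;> linarith

/-- The residual `(H - E) φ` of the almost Mathieu operator with frequency `μ` and phase `θ`. -/
noncomputable def residual (μ θ E : ℝ) (φ : ℤ → ℂ) (n : ℤ) : ℂ :=
  φ (n + 1) + φ (n - 1) + ((2 * Real.cos (2 * π * μ * n + θ) - E : ℝ) : ℂ) * φ n

/-- The energies that are approximate eigenvalues of `H_{μ,θ}` for some phase `θ`. -/
def approxSpectrum (μ : ℝ) : Set ℝ :=
  {E | ∃ θ : ℝ, ∀ η > 0, ∃ φ : ℤ → ℂ, Summable (fun n => ‖φ n‖ ^ 2) ∧ 0 < ∑' n, ‖φ n‖ ^ 2 ∧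
    Summable (fun n => ‖residual μ θ E φ n‖ ^ 2) ∧
    ∑' n, ‖residual μ θ E φ n‖ ^ 2 ≤ η ^ 2 * ∑' n, ‖φ n‖ ^ 2}

/-- Weyl's criterion: a symmetric operator that is bounded below is invertible. -/
theorem isUnit_of_symmetric_of_le_norm {X : Type*} [NormedAddCommGroup X] [InnerProductSpace ℂ X]
    [CompleteSpace X] (A : X →L[ℂ] X) (hA : ∀ x y, inner ℂ (A x) y = inner ℂ x (A y)) {η : ℝ}
    (hη : 0 < η) (h : ∀ x, η * ‖x‖ ≤ ‖A x‖) : IsUnit A := by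
  have h2 : IsUnit (A * A) := by
    refine ContinuousLinearMap.isUnit_of_forall_le_norm_inner_map _
      (c := ⟨η ^ 2, by positivity⟩) (by exact_mod_cast pow_pos hη 2) fun x => ?_
    rw [mul_apply_eq_comp, hA, inner_self_eq_norm_sq_to_K]
    have := pow_le_pow_left₀ (by positivity) (h x) 2
    rw [mul_pow, mul_comm] at this
    change ‖x‖ ^ 2 * η ^ 2 ≤ _
    refine this.trans_eq ?_
    rw [norm_pow, RCLike.norm_ofReal, abs_of_nonneg (norm_nonneg _)]
  exact isUnit_mul_self_iff.1 h2

theorem hasSum_inner_shift_sub {x y : ℤ → ℂ} (hx : Summable fun n => ‖x n‖ ^ 2)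
    (hy : Summable fun n => ‖y n‖ ^ 2) :
    HasSum (fun n => inner ℂ (x (n + 1)) (y n) - inner ℂ (x n) (y (n - 1))) 0 := by
  have hs : Summable fun n => inner ℂ (x (n + 1)) (y n) := by
    refine Summable.of_norm_bounded ((hx.comp_injective (add_left_injective 1)).add hy) fun n => ?_
    refine (norm_inner_le_norm _ _).trans ?_
    simp only [Function.comp_apply]
    nlinarith [sq_nonneg (‖x (n + 1)‖ - ‖y n‖), sq_nonneg ‖x (n + 1)‖, sq_nonneg ‖y n‖]
  have h1 := (Equiv.subRight (1 : ℤ)).hasSum_iff.2 hs.hasSum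
  have h2 := hs.hasSum.sub h1
  rw [sub_self] at h2
  simpa using h2

theorem inner_action_symm {μ θ : ℝ} {H : lp (fun _ : ℤ => ℂ) 2 →L[ℂ] lp (fun _ : ℤ => ℂ) 2}
    (hH : ∀ (u : lp (fun _ : ℤ => ℂ) 2) (n : ℤ), H u n = u (n + 1) + u (n - 1)
      + ((2 * Real.cos (2 * π * μ * n + θ) : ℝ) : ℂ) * u n)
    (x y : lp (fun _ : ℤ => ℂ) 2) : inner ℂ (H x) y = inner ℂ x (H y) := by
  have hns (u : lp (fun _ : ℤ => ℂ) 2) : Summable fun n => ‖u n‖ ^ 2 := by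
    have h0 := (lp.hasSum_norm (p := 2) (by norm_num) u).summable
    simpa only [ENNReal.toReal_ofNat, Real.rpow_ofNat] using h0
  have h1 : Summable fun n => inner ℂ (H x n) (y n) := lp.summable_inner (𝕜 := ℂ) (H x) y
  have h2 : Summable fun n => inner ℂ (x n) (H y n) := lp.summable_inner (𝕜 := ℂ) x (H y)
  rw [lp.inner_eq_tsum, lp.inner_eq_tsum, ← sub_eq_zero, ← h1.tsum_sub h2]
  have h3 := (hasSum_inner_shift_sub (hns x) (hns y))
  have h4 := Complex.hasSum_conj'.2 (hasSum_inner_shift_sub (hns y) (hns x))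
  have h5 := h3.sub h4
  rw [map_zero, sub_zero] at h5
  rw [← h5.tsum_eq]
  refine tsum_congr fun n => ?_
  simp only [hH, RCLike.inner_apply, map_add, map_mul, map_sub, Complex.conj_ofReal,
    Complex.conj_conj]
  ring

theorem mem_approxSpectrum {μ θ : ℝ} {H : lp (fun _ : ℤ => ℂ) 2 →L[ℂ] lp (fun _ : ℤ => ℂ) 2}
    (hH : ∀ (u : lp (fun _ : ℤ => ℂ) 2) (n : ℤ), H u n = u (n + 1) + u (n - 1)
      + ((2 * Real.cos (2 * π * μ * n + θ) : ℝ) : ℂ) * u n)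
    {E : ℝ} (hE : (E : ℂ) ∈ spectrum ℂ H) : E ∈ approxSpectrum μ := by
  refine ⟨θ, fun η hη => ?_⟩
  by_contra! hcon
  refine hE ?_
  rw [spectrum.mem_resolventSet_iff, ← IsUnit.neg_iff, neg_sub]
  set A := H - algebraMap ℂ _ (E : ℂ)
  have hA0 (u : lp (fun _ : ℤ => ℂ) 2) : A u = H u - (E : ℂ) • u := rfl
  have hA (u : lp (fun _ : ℤ => ℂ) 2) (n : ℤ) : A u n = residual μ θ E u n := by
    rw [hA0, lp.coeFn_sub, lp.coeFn_smul, Pi.sub_apply, Pi.smul_apply, hH, residual, smul_eq_mul]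
    push_cast
    ring
  have hns (u : lp (fun _ : ℤ => ℂ) 2) : HasSum (fun n => ‖u n‖ ^ 2) (‖u‖ ^ 2) := by
    have h0 := lp.hasSum_norm (p := 2) (by norm_num) u
    simpa only [ENNReal.toReal_ofNat, Real.rpow_ofNat] using h0
  refine isUnit_of_symmetric_of_le_norm _ (fun x y => ?_) hη fun u => ?_
  · rw [hA0, hA0, inner_sub_left, inner_sub_right, inner_action_symm hH, inner_smul_left,
      inner_smul_right, Complex.conj_ofReal]
  · rcases eq_or_ne u 0 with rfl | hu
    · simp
    have h1 := hns u
    have h2 := hns (A u)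
    simp only [hA] at h2
    have hpos : 0 < ‖u‖ := norm_pos_iff.2 hu
    have := hcon u h1.summable (by rw [h1.tsum_eq]; positivity) h2.summable
    rw [h1.tsum_eq, h2.tsum_eq, ← mul_pow] at this
    exact (lt_of_pow_lt_pow_left₀ 2 (norm_nonneg _) this).le

theorem tsum_le_of_shift {g h : ℤ → ℝ} (hg : Summable g) (hh : Summable h) {A a b D : ℝ}
    (k l : ℤ) (m : ℕ)
    (hle : ∀ n, A * g n ≤ a * g (n + k) + a * g (n - k) + b * g (n + 1) +
      D * ∑ j ∈ Finset.range m, h (n + l + j)) :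
    A * ∑' n, g n ≤ (2 * a + b) * ∑' n, g n + D * (m * ∑' n, h n) := by
  have hshift {g : ℤ → ℝ} (hg : Summable g) (k : ℤ) : HasSum (fun n => g (n + k)) (∑' n, g n) :=
    (Equiv.addRight k).hasSum_iff.2 hg.hasSum
  have hr : HasSum (fun n => a * g (n + k) + a * g (n - k) + b * g (n + 1) +
      D * ∑ j ∈ Finset.range m, h (n + l + j))
      (a * ∑' n, g n + a * ∑' n, g n + b * ∑' n, g n +
        D * ∑ j ∈ Finset.range m, ∑' n, h n) := by
    refine ((((hshift hg k).mul_left a).add ((hshift hg (-k)).mul_left a)).add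
      ((hshift hg 1).mul_left b)).add ((hasSum_sum fun j _ => ?_).mul_left D)
    simpa [add_assoc] using hshift hh (l + j)
  have := hasSum_le hle (hg.hasSum.mul_left A) hr
  rw [Finset.sum_const, Finset.card_range, nsmul_eq_mul] at this
  linarith

theorem abs_le_five {μ E : ℝ} (hE : E ∈ approxSpectrum μ) : |E| ≤ 5 := by
  obtain ⟨θ, h⟩ := hE
  obtain ⟨φ, hφ, hpos, hf, hle⟩ := h 1 one_pos
  have := tsum_le_of_shift hφ hf (A := |E| - 2 - 3 / 2) (a := 1 / 2) (b := 0) (D := 1 / 2) 1 0 1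
    fun n => ?_
  · push_cast at this
    nlinarith
  · have hEn : (E : ℂ) * φ n = φ (n + 1) + φ (n - 1) +
        ((2 * Real.cos (2 * π * μ * n + θ) : ℝ) : ℂ) * φ n - residual μ θ E φ n := by
      rw [residual]; push_cast; ring
    have h1 := congrArg norm hEn
    have h2 := (norm_sub_le _ _).trans' h1.le
    have h3 := norm_add₃_le (a := φ (n + 1)) (b := φ (n - 1))
      (c := ((2 * Real.cos (2 * π * μ * n + θ) : ℝ) : ℂ) * φ n)
    rw [norm_mul, Complex.norm_real, Real.norm_eq_abs] at h2 h3
    have hc : |2 * Real.cos (2 * π * μ * n + θ)| ≤ 2 := by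
      rw [abs_mul, abs_two]
      linarith [Real.abs_cos_le_one (2 * π * μ * n + θ)]
    have h4 := mul_le_mul_of_nonneg_right hc (norm_nonneg (φ n))
    have h5 : |E| * ‖φ n‖ ≤ ‖φ (n + 1)‖ + ‖φ (n - 1)‖ + 2 * ‖φ n‖ + ‖residual μ θ E φ n‖ := by
      linarith
    have h6 := mul_le_mul_of_nonneg_right h5 (norm_nonneg (φ n))
    simp only [Finset.sum_range_one, Nat.cast_zero, add_zero]
    nlinarith [sq_nonneg (‖φ (n + 1)‖ - ‖φ n‖), sq_nonneg (‖φ (n - 1)‖ - ‖φ n‖),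
      sq_nonneg (‖residual μ θ E φ n‖ - ‖φ n‖)]

/-- The point of the unit circle with frequency `μ`. -/
noncomputable def freq (μ : ℝ) : ℂ := Complex.exp ((2 * π * μ : ℝ) * Complex.I)

theorem norm_freq (μ : ℝ) : ‖freq μ‖ = 1 := Complex.norm_exp_ofReal_mul_I _

theorem continuous_freq : Continuous freq := by
  unfold freq
  fun_prop

theorem coef_freq (μ t E : ℝ) (j : ℕ) :
    coef (freq μ) (Complex.exp (t * Complex.I)) E j = E - 2 * Real.cos (2 * π * μ * j + t) := by
  rw [coef, freq, ← Complex.exp_nat_mul, ← Complex.exp_add,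
    ← Complex.exp_ofReal_mul_I_re (2 * π * μ * j + t)]
  congr 4
  push_cast
  ring

theorem sq_le_of_three_term (μ θ E : ℝ) (hE : |E| ≤ 5) {q : ℕ} {δ : ℝ} (hδ : 0 < δ)
    (hyp : ∀ z z' : ℂ, ‖z'‖ = 1 → z = z' * freq μ ^ q →
      2 + δ / 2 ≤ |(transfer 1 (coef (freq μ) z E) q).trace| ∧
        ∀ i j, |transfer 1 (coef (freq μ) z E) q i j - transfer 1 (coef (freq μ) z' E) q i j| ≤
          δ / 16) (φ : ℤ → ℂ) (n : ℤ) :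
    (1 + 11 * δ / 32) * ‖φ n‖ ^ 2 ≤ 1 / 2 * ‖φ (n + q)‖ ^ 2 + 1 / 2 * ‖φ (n - q)‖ ^ 2 +
      δ / 32 * ‖φ (n + 1)‖ ^ 2 + 4 / δ * (2 * (8 ^ q) ^ 2) ^ 2 * (2 * q) *
        ∑ j ∈ Finset.range (2 * q), ‖residual μ θ E φ (n + (1 - q) + j)‖ ^ 2 := by
  set z' := Complex.exp ((2 * π * μ * (n - q + 1) + θ : ℝ) * Complex.I) with hz'
  have hz'1 : ‖z'‖ = 1 := Complex.norm_exp_ofReal_mul_I _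
  obtain ⟨h1, h2⟩ := hyp _ z' hz'1 rfl
  have h3 := (three_term_le (x := coef (freq μ) z' E) (B := 7) (by norm_num)
    (abs_coef_le (norm_freq μ) hz'1 hE) (fun j => φ (n - q + j)) q (κ := δ / 16)
    (by simpa only [coef_add] using h2)).2
  have hdef (j : ℕ) : defect (coef (freq μ) z' E) (fun j => φ (n - q + j)) j =
      residual μ θ E φ (n + (1 - q) + j) := by
    rw [defect, hz', coef_freq, residual]
    have e1 : n - q + (j + 2 : ℕ) = n + (1 - q) + j + 1 := by push_cast; ring
    have e2 : n - q + (j : ℕ) = n + (1 - q) + j - 1 := by ring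
    have e3 : n - q + (j + 1 : ℕ) = n + (1 - q) + j := by push_cast; ring
    have e4 : 2 * π * μ * j + (2 * π * μ * (n - q + 1) + θ) =
      2 * π * μ * (n + (1 - q) + j : ℤ) + θ := by push_cast; ring
    rw [e1, e2, e3, e4]
    push_cast
    ring
  simp only [coef_add, hdef] at h3
  have f1 : n - q + (2 * q : ℕ) = n + q := by push_cast; ring
  have f2 : n - q + (0 : ℕ) = n - q := by simp
  have f3 : n - q + (q + 1 : ℕ) = n + 1 := by push_cast; ring
  have f4 : n - (q : ℤ) + q = n := by ring
  rw [f1, f2, f3, f4] at h3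
  set T := (transfer 1 (coef (freq μ) (z' * freq μ ^ q) E) q).trace
  set R := ∑ j ∈ Finset.range (2 * q), ‖residual μ θ E φ (n + (1 - q) + j)‖ with hR
  set C : ℝ := 2 * (8 ^ q) ^ 2 with hC
  have hR2 : R ^ 2 ≤ (2 * q) *
      ∑ j ∈ Finset.range (2 * q), ‖residual μ θ E φ (n + (1 - q) + j)‖ ^ 2 := by
    have := sq_sum_le_card_mul_sum_sq (s := Finset.range (2 * q))
      (f := fun j : ℕ => ‖residual μ θ E φ (n + (1 - q) + j)‖)
    simpa using this
  have h4 : |T| * ‖φ n‖ ≤ ‖φ (n + q)‖ + ‖φ (n - q)‖ +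
      (δ / 16 * (‖φ (n + 1)‖ + ‖φ n‖) + C * R) := by
    have e : (T : ℂ) * φ n = (φ (n + q) + φ (n - q)) - (φ (n + q) + φ (n - q) - T * φ n) := by ring
    have h := congrArg norm e
    rw [norm_mul, Complex.norm_real, Real.norm_eq_abs] at h
    rw [h]
    refine (norm_sub_le _ _).trans (add_le_add (norm_add_le _ _) ?_)
    norm_num at h3
    exact h3
  have hy := norm_nonneg (φ n)
  have h5 := (mul_le_mul_of_nonneg_right h1 hy).trans h4
  have h6 := mul_le_mul_of_nonneg_right h5 hy
  have h7 : C * R * ‖φ n‖ ≤ δ / 16 * ‖φ n‖ ^ 2 + 4 / δ * C ^ 2 * R ^ 2 := by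
    have e : δ / 16 * ‖φ n‖ ^ 2 + 4 / δ * C ^ 2 * R ^ 2 - C * R * ‖φ n‖ =
      4 / δ * (C * R - δ / 8 * ‖φ n‖) ^ 2 := by
      field_simp
      ring
    have : 0 ≤ 4 / δ * (C * R - δ / 8 * ‖φ n‖) ^ 2 := by positivity
    linarith
  have h8 := mul_le_mul_of_nonneg_left hR2 (show 0 ≤ 4 / δ * C ^ 2 by positivity)
  have h9 := mul_nonneg hδ.le (sq_nonneg (‖φ (n + 1)‖ - ‖φ n‖))
  rw [mul_assoc _ (2 * (q : ℝ))]
  nlinarith [sq_nonneg (‖φ (n + q)‖ - ‖φ n‖), sq_nonneg (‖φ (n - q)‖ - ‖φ n‖)]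

theorem notMem_approxSpectrum {μ E : ℝ} (hE : |E| ≤ 5) {q : ℕ} {δ : ℝ} (hδ : 0 < δ)
    (hyp : ∀ z z' : ℂ, ‖z'‖ = 1 → z = z' * freq μ ^ q →
      2 + δ / 2 ≤ |(transfer 1 (coef (freq μ) z E) q).trace| ∧
        ∀ i j, |transfer 1 (coef (freq μ) z E) q i j - transfer 1 (coef (freq μ) z' E) q i j| ≤
          δ / 16) : E ∉ approxSpectrum μ := by
  rintro ⟨θ, h⟩
  set D : ℝ := 4 / δ * (2 * (8 ^ q) ^ 2) ^ 2 * (2 * q) with hD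
  have hD0 : 0 ≤ D := by positivity
  set K : ℝ := D * (2 * q) + 1 with hK
  have hK0 : 0 < K := by positivity
  obtain ⟨φ, hφ, hpos, hf, hle⟩ := h (Real.sqrt (δ / (8 * K))) (by positivity)
  rw [Real.sq_sqrt (by positivity)] at hle
  have h1 := tsum_le_of_shift hφ hf q (1 - q) (2 * q) (sq_le_of_three_term μ θ E hE hδ hyp φ)
  set G := ∑' n, ‖φ n‖ ^ 2
  set F := ∑' n, ‖residual μ θ E φ n‖ ^ 2
  have hF : 0 ≤ F := tsum_nonneg fun n => sq_nonneg _
  have h2 : D * (2 * q) * F ≤ K * F := by gcongr; linarith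
  have h3 : K * F ≤ δ / 8 * G := by
    refine (mul_le_mul_of_nonneg_left hle hK0.le).trans_eq ?_
    field_simp
  rw [← hD] at h1
  push_cast at h1
  have := mul_pos hδ hpos
  nlinarith

theorem abs_chambers_lt_of_approxSpectrum {μ₀ : ℝ} {q : ℕ} (hω₀ : IsPrimitiveRoot (freq μ₀) q)
    (hq : 0 < q) {δ : ℝ} (hδ : 0 < δ) :
    ∀ᶠ μ in nhds μ₀, ∀ E ∈ approxSpectrum μ, |chambers (freq μ₀) q E| < 4 + δ := by
  obtain ⟨r, hr, H⟩ := exists_hyperbolic_radius hω₀ hq hδ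
  have hc2 : Filter.Tendsto (fun μ => freq μ ^ q) (nhds μ₀) (nhds 1) := by
    have := (continuous_freq.pow q).tendsto μ₀
    rwa [Pi.pow_apply, hω₀.pow_eq_one] at this
  filter_upwards [continuous_freq.continuousAt.eventually (Metric.ball_mem_nhds _ hr),
    hc2.eventually (Metric.ball_mem_nhds _ hr)] with μ h1 h2 E hE
  by_contra! hlt
  refine notMem_approxSpectrum (q := q) (abs_le_five hE) hδ (fun z z' hz' hzz => ?_) hE
  have hz : ‖z‖ = 1 := by rw [hzz, norm_mul, norm_pow, norm_freq, hz', one_pow, mul_one]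
  refine H _ z z' z' E (norm_freq μ) hz hz' hz' (abs_le_five hE) h1 ?_ (by simpa using hr) ?_
  · rw [dist_eq_norm, hzz, show z' * freq μ ^ q - z' = z' * (freq μ ^ q - 1) by ring, norm_mul,
      hz', one_mul, ← dist_eq_norm]
    exact h2
  · have h3 := Complex.abs_re_le_norm (z' ^ q)
    rw [norm_pow, hz', one_pow] at h3
    have h4 := abs_sub_abs_le_abs_sub (chambers (freq μ₀) q E) (2 * (z' ^ q).re)
    rw [abs_mul, abs_two] at h4
    linarith

open Matrix in
theorem exists_eigenvector_transfer (x : ℕ → ℝ) (k : ℕ)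
    (ht : |(transfer 1 x k).trace| ≤ 2) :
    ∃ (ζ : ℂ) (v : Fin 2 → ℂ), ‖ζ‖ = 1 ∧ v ≠ 0 ∧
      (transfer 1 x k).map Complex.ofReal *ᵥ v = ζ • v := by
  have hdet := det_transfer x k
  set T := transfer 1 x k
  set t := T.trace with htr
  have ht2 : t ^ 2 ≤ 4 := by
    have := pow_le_pow_left₀ (abs_nonneg t) ht 2
    rw [sq_abs] at this
    linarith
  set w := Real.sqrt (1 - t ^ 2 / 4) with hw
  have hw2 : w ^ 2 = 1 - t ^ 2 / 4 := Real.sq_sqrt (by linarith)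
  set ζ : ℂ := ⟨t / 2, w⟩
  have hζ : ζ ^ 2 - t * ζ + 1 = 0 := by
    apply Complex.ext
    · simp [ζ, sq]
      linarith
    · simp [ζ, sq]
      ring
  have hζ1 : ‖ζ‖ = 1 := by
    rw [← sq_eq_sq₀ (norm_nonneg _) zero_le_one, Complex.sq_norm, Complex.normSq_mk]
    linarith
  have hz : (T.map Complex.ofReal - ζ • (1 : Matrix (Fin 2) (Fin 2) ℂ)).det = 0 := by
    have h1 : (T 0 0 : ℂ) * T 1 1 - T 0 1 * T 1 0 = 1 := by
      rw [Matrix.det_fin_two] at hdet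
      exact_mod_cast hdet
    have h2 : (t : ℂ) = T 0 0 + T 1 1 := by
      rw [htr, Matrix.trace_fin_two]
      push_cast
      rfl
    rw [Matrix.det_fin_two]
    simp only [Matrix.sub_apply, Matrix.map_apply, Matrix.smul_apply, Matrix.one_apply_eq,
      smul_eq_mul, mul_one, ne_eq, zero_ne_one, one_ne_zero, not_false_eq_true,
      Matrix.one_apply_ne, mul_zero, sub_zero]
    rw [h2] at hζ
    linear_combination hζ + h1
  obtain ⟨v, hv, hv0⟩ := Matrix.exists_mulVec_eq_zero_iff.2 hz
  refine ⟨ζ, v, hζ1, hv, ?_⟩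
  rwa [Matrix.sub_mulVec, Matrix.smul_mulVec, Matrix.one_mulVec, sub_eq_zero] at hv0

/-- Floquet theory for a periodic Jacobi operator at an energy inside a band. -/
theorem exists_bloch (x : ℕ → ℝ) {q : ℕ} (hq : 0 < q) (hx : ∀ j, x (j + q) = x j)
    (ht : |(transfer 1 x q).trace| ≤ 2) :
    ∃ φ : ℕ → ℂ, (∀ j, defect x φ j = 0) ∧ (∀ n, ‖φ (n + q)‖ = ‖φ n‖) ∧
      (∀ n, ‖φ n‖ ≤ 1) ∧ ∃ n, ‖φ n‖ = 1 := by
  obtain ⟨ζ, v, hζ, hv, hT⟩ := exists_eigenvector_transfer x q ht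
  set ψ : ℕ → ℂ := fun n => transfer 1 x n 1 0 * v 0 + transfer 1 x n 1 1 * v 1 with hψ
  have hψ1 (n : ℕ) : ψ (n + 1) = transfer 1 x n 0 0 * v 0 + transfer 1 x n 0 1 * v 1 := by
    simp [hψ, transfer_succ_entries]
  have hdef (j : ℕ) : defect x ψ j = 0 := by
    rw [defect, hψ1 (j + 1), hψ1 j, (transfer_succ_entries 1 x j 0).1,
      (transfer_succ_entries 1 x j 1).1, hψ]
    push_cast
    ring
  have h0 : ψ 0 = v 1 := by simp [hψ, transfer]
  have h1 : ψ 1 = v 0 := by simp [hψ1, transfer]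
  have hper (n : ℕ) : ψ (n + q) = ζ * ψ n ∧ ψ (n + 1 + q) = ζ * ψ (n + 1) := by
    induction n with
    | zero =>
      rw [zero_add, zero_add, h0, h1, add_comm 1 q, hψ1]
      have e0 := congrFun hT 0
      have e1 := congrFun hT 1
      simp only [Matrix.mulVec, dotProduct, Fin.sum_univ_two, Matrix.map_apply, Pi.smul_apply,
        smul_eq_mul] at e0 e1
      exact ⟨e1, e0⟩
    | succ n ih =>
      refine ⟨ih.2, ?_⟩
      have e0 := hdef n
      have e1 := hdef (n + q)
      rw [defect] at e0 e1
      rw [hx, show n + q + 2 = n + 1 + 1 + q by ring, show n + q + 1 = n + 1 + q by ring, ih.1,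
        ih.2] at e1
      linear_combination e1 - ζ * e0
  have hnorm (n : ℕ) : ‖ψ (n + q)‖ = ‖ψ n‖ := by rw [(hper n).1, norm_mul, hζ, one_mul]
  obtain ⟨m, -, hm⟩ := (Finset.range q).exists_max_image (fun n => ‖ψ n‖) ⟨0, by simpa⟩
  have hmax (n : ℕ) : ‖ψ n‖ ≤ ‖ψ m‖ := by
    have hp : Function.Periodic (fun n => ‖ψ n‖) q := hnorm
    have := hp.map_mod_nat n
    change ‖ψ (n % q)‖ = ‖ψ n‖ at this
    rw [← this]
    exact hm _ (by simpa using Nat.mod_lt n hq)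
  have hpos : 0 < ‖ψ m‖ := by
    by_contra! hle
    have hz (n : ℕ) : ψ n = 0 := norm_le_zero_iff.1 ((hmax n).trans hle)
    refine hv (funext fun i => ?_)
    fin_cases i
    · exact h1.symm.trans (hz 1)
    · exact h0.symm.trans (hz 0)
  refine ⟨fun n => ψ n / (‖ψ m‖ : ℂ), fun j => ?_, fun n => ?_, fun n => ?_, m, ?_⟩
  · have := hdef j
    rw [defect] at this ⊢
    linear_combination this / (‖ψ m‖ : ℂ)
  · simp only [norm_div, hnorm]
  · simp only [norm_div, Complex.norm_real, norm_norm]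
    exact div_le_one_of_le₀ (hmax n) hpos.le
  · simp only [norm_div, Complex.norm_real, norm_norm]
    exact div_self hpos.ne'

theorem exists_phase {q : ℕ} (hq : 0 < q) {ε : ℝ} (hε : |ε| = 1) :
    ∃ z : ℂ, ‖z‖ = 1 ∧ z ^ q = ε := by
  obtain ⟨z, hz⟩ := IsAlgClosed.exists_pow_nat_eq (ε : ℂ) hq
  refine ⟨z, ?_, hz⟩
  have := congrArg norm hz
  rw [norm_pow, Complex.norm_real, Real.norm_eq_abs, hε] at this
  exact (pow_eq_one_iff_of_nonneg (norm_nonneg z) hq.ne').1 this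

/-- Every energy with `|chambers ω q E| ≤ 4` carries a Bloch wave. -/
theorem exists_bloch_of_chambers {ω : ℂ} {q : ℕ} (hω : IsPrimitiveRoot ω q) (hq : 0 < q) {E : ℝ}
    (hE : |chambers ω q E| ≤ 4) :
    ∃ z : ℂ, ‖z‖ = 1 ∧ z ^ (2 * q) = 1 ∧ ∃ φ : ℕ → ℂ, (∀ j, defect (coef ω z E) φ j = 0) ∧
      (∀ n, ‖φ (n + q)‖ = ‖φ n‖) ∧ (∀ n, ‖φ n‖ ≤ 1) ∧ ∃ n, ‖φ n‖ = 1 := by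
  obtain ⟨ε, hε, hle⟩ : ∃ ε : ℝ, |ε| = 1 ∧ |chambers ω q E - 2 * ε| ≤ 2 := by
    rw [abs_le] at hE
    rcases le_total 0 (chambers ω q E) with h | h
    · exact ⟨1, abs_one, abs_le.2 ⟨by linarith, by linarith⟩⟩
    · exact ⟨-1, by simp, abs_le.2 ⟨by linarith, by linarith⟩⟩
  obtain ⟨z, hz, hzq⟩ := exists_phase hq hε
  refine ⟨z, hz, ?_, exists_bloch _ hq (fun j => ?_) ?_⟩
  · rw [mul_comm, pow_mul, hzq, ← Complex.ofReal_pow, ← sq_abs, hε, one_pow, Complex.ofReal_one]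
  · rw [coef, coef, pow_add, hω.pow_eq_one, mul_one]
  · rwa [trace_transfer_coef hω hq hz, hzq, Complex.ofReal_re]

theorem abs_le_four_of_chambers {ω : ℂ} {q : ℕ} (hω : IsPrimitiveRoot ω q) (hq : 0 < q) {E : ℝ}
    (hE : |chambers ω q E| ≤ 4) : |E| ≤ 4 := by
  obtain ⟨z, hz, -, φ, hdef, hper, hle, n, hn⟩ := exists_bloch_of_chambers hω hq hE
  have hω1 : ‖ω‖ = 1 := hω.norm'_eq_one hq.ne'
  have hn' : ‖φ (n + q - 1 + 1)‖ = 1 := by rw [Nat.sub_add_cancel (by omega), hper, hn]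
  set m := n + q - 1
  have h := congrArg norm (sub_eq_zero.1 (hdef m))
  rw [norm_mul, hn', Complex.norm_real, Real.norm_eq_abs, mul_one] at h
  have h1 := norm_add_le (φ (m + 2)) (φ m)
  have h2 := Complex.abs_re_le_norm (z * ω ^ m)
  rw [norm_mul, norm_pow, hω1, hz, one_pow, mul_one] at h2
  have h3 : |E - 2 * (z * ω ^ m).re| ≤ 2 := by
    rw [coef] at h
    linarith [hle m, hle (m + 2)]
  rw [abs_le] at *
  constructor <;> linarith

open Polynomial in
theorem exists_polynomial_chambers (ω : ℂ) (q : ℕ) :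
    ∃ P : ℝ[X], ∀ E, P.eval E = chambers ω q E := by
  refine ⟨(transfer 1 (fun j => X - C (2 * (1 * ω ^ j).re)) q).trace + 2, fun E => ?_⟩
  have := trace_transfer_map (evalRingHom E) 1 (fun j => X - C (2 * (1 * ω ^ j).re)) q
  simp only [coe_evalRingHom, eval_one, eval_sub, eval_X, eval_C] at this
  rw [eval_add, this, chambers, eval_ofNat]
  rfl

theorem continuous_chambers (ω : ℂ) (q : ℕ) : Continuous (chambers ω q) := by
  obtain ⟨P, hP⟩ := exists_polynomial_chambers ω q
  simpa only [← funext hP] using P.continuous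

theorem finite_chambers_eq_zero {ω : ℂ} {q : ℕ} (hω : IsPrimitiveRoot ω q) (hq : 0 < q) :
    {E | chambers ω q E = 0}.Finite := by
  obtain ⟨P, hP⟩ := exists_polynomial_chambers ω q
  have hP0 : P ≠ 0 := by
    rintro rfl
    have h6 := hP 6
    rw [Polynomial.eval_zero] at h6
    have := abs_le_four_of_chambers hω hq (E := 6) (by rw [← h6]; norm_num)
    norm_num at this
  refine (Polynomial.finite_setOfPred_isRoot hP0).subset fun E hE => ?_
  exact (hP E).trans hE

open Matrix in
/-- An approximate eigenvalue of a Hermitian matrix is close to an eigenvalue. -/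
theorem exists_eigenvalue_near {ι : Type*} [Fintype ι] [DecidableEq ι] {A : Matrix ι ι ℂ}
    (hA : A.IsHermitian) {u : ι → ℂ} {E η : ℝ} (hη : 0 ≤ η) (hu : 0 < ∑ i, ‖u i‖ ^ 2)
    (h : ∑ i, ‖(A *ᵥ u) i - E * u i‖ ^ 2 ≤ η ^ 2 * ∑ i, ‖u i‖ ^ 2) :
    ∃ i, |hA.eigenvalues i - E| ≤ η := by
  by_contra! hcon
  set b := hA.eigenvectorBasis
  set U : EuclideanSpace ℂ ι := WithLp.toLp 2 u with hU
  set V : EuclideanSpace ℂ ι := WithLp.toLp 2 (fun i => (A *ᵥ u) i - E * u i) with hV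
  have hVU : V = Matrix.toEuclideanLin A U - (E : ℂ) • U := by
    ext i
    simp [hV, hU]
  have hin (i : ι) : inner ℂ (b i) V = ((hA.eigenvalues i - E : ℝ) : ℂ) * inner ℂ (b i) U := by
    have h1 : Matrix.toEuclideanLin A (b i) = (hA.eigenvalues i : ℂ) • b i := by
      ext j
      have := congrFun (hA.mulVec_eigenvectorBasis i) j
      simpa using this
    rw [hVU, inner_sub_right, ← Matrix.isSymmetric_toEuclideanLin_iff.2 hA (b i) U, h1,
      inner_smul_left, inner_smul_right, Complex.conj_ofReal]
    push_cast
    ring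
  have hUn : ∑ i, ‖inner ℂ (b i) U‖ ^ 2 = ∑ i, ‖u i‖ ^ 2 := by
    rw [b.sum_sq_norm_inner_right, EuclideanSpace.norm_sq_eq]
  have hVn : ∑ i, ‖inner ℂ (b i) V‖ ^ 2 = ∑ i, ‖(A *ᵥ u) i - E * u i‖ ^ 2 := by
    rw [b.sum_sq_norm_inner_right, EuclideanSpace.norm_sq_eq]
  rw [← hVn, ← hUn, Finset.mul_sum] at h
  rw [← hUn] at hu
  have hle (i : ι) : η ^ 2 * ‖inner ℂ (b i) U‖ ^ 2 ≤ ‖inner ℂ (b i) V‖ ^ 2 := by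
    rw [hin, norm_mul, mul_pow, Complex.norm_real, Real.norm_eq_abs]
    gcongr
    exact (hcon i).le
  obtain ⟨i, -, hi⟩ := Finset.exists_ne_zero_of_sum_ne_zero hu.ne'
  refine h.not_gt (Finset.sum_lt_sum (fun i _ => hle i) ⟨i, Finset.mem_univ _, ?_⟩)
  rw [hin, norm_mul, mul_pow, Complex.norm_real, Real.norm_eq_abs]
  exact mul_lt_mul_of_pos_right (pow_lt_pow_left₀ (hcon i) hη two_ne_zero)
    ((sq_nonneg _).lt_of_ne' hi)

/-- The restriction of the almost Mathieu operator to `q` consecutive sites. -/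
noncomputable def box (ω w : ℂ) (q : ℕ) : Matrix (Fin q) (Fin q) ℂ :=
  Matrix.of fun i j => (if (j : ℕ) = i then ((2 * (w * ω ^ (i : ℕ)).re : ℝ) : ℂ) else 0) +
    (if (j : ℕ) = i + 1 then 1 else 0) + (if (i : ℕ) = j + 1 then 1 else 0)

theorem box_isHermitian (ω w : ℂ) (q : ℕ) : (box ω w q).IsHermitian := by
  refine Matrix.IsHermitian.ext fun i j => ?_
  simp only [box, Matrix.of_apply, star_add, apply_ite star, star_one, star_zero, Complex.star_def,
    Complex.conj_ofReal]
  rw [add_assoc, add_assoc, add_comm (ite ((i : ℕ) = j + 1) _ _)]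
  congr 1
  by_cases h : (i : ℕ) = j
  · rw [if_pos h, if_pos h.symm, h]
  · rw [if_neg h, if_neg (Ne.symm h)]

open Matrix in
theorem box_mulVec (ω w : ℂ) {q : ℕ} (ψ : ℕ → ℂ) (i : Fin q) :
    (box ω w q *ᵥ fun j => ψ (j + 1)) i = ((2 * (w * ω ^ (i : ℕ)).re : ℝ) : ℂ) * ψ (i + 1) +
      (ψ (i + 2) - if (i : ℕ) + 1 = q then ψ (i + 2) else 0) +
        (ψ i - if (i : ℕ) = 0 then ψ 0 else 0) := by
  obtain ⟨i, hi⟩ := i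
  simp only [box, Matrix.mulVec, dotProduct, Matrix.of_apply, add_mul, ite_mul, zero_mul, one_mul,
    Finset.sum_add_distrib]
  rw [Fin.sum_univ_eq_sum_range (fun j => if j = i then
      ((2 * (w * ω ^ i).re : ℝ) : ℂ) * ψ (j + 1) else 0),
    Fin.sum_univ_eq_sum_range (fun j => if j = i + 1 then ψ (j + 1) else 0),
    Fin.sum_univ_eq_sum_range (fun j => if i = j + 1 then ψ (j + 1) else 0)]
  congr 1
  · congr 1
    · simp [hi]
    · rw [Finset.sum_ite_eq' (Finset.range q) (i + 1)]
      by_cases h : i + 1 = q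
      · simp [h]
      · simp [h, show i + 1 < q by omega]
  · cases i with
    | zero => simp
    | succ i => simp [show i < q by omega]

/-- A periodic solution that is small at the ends of a period is almost an eigenvector of the
box. -/
theorem exists_box_eigenvalue {ω z : ℂ} {q : ℕ} (hq : 0 < q) {E : ℝ} {φ : ℕ → ℂ}
    (hdef : ∀ j, defect (coef ω z E) φ j = 0) (hper : ∀ n, ‖φ (n + q)‖ = ‖φ n‖)
    (hone : ∃ n, ‖φ n‖ = 1) {m : ℕ} {τ : ℝ} (h0 : ‖φ m‖ ≤ τ) (h1 : ‖φ (m + 1)‖ ≤ τ) :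
    ∃ i, |(box_isHermitian ω (z * ω ^ m) q).eigenvalues i - E| ≤ 2 * τ := by
  have hτ : 0 ≤ τ := (norm_nonneg _).trans h0
  have hsum : 1 ≤ ∑ i : Fin q, ‖φ (m + (i + 1))‖ ^ 2 := by
    obtain ⟨n, hn⟩ := hone
    have hp : Function.Periodic (fun n => ‖φ n‖) q := hper
    obtain ⟨i, hi, hmod⟩ : ∃ i < q, (m + (i + 1)) % q = n % q := by
      refine ⟨(n + (q - 1) * (m + 1)) % q, Nat.mod_lt _ hq, ?_⟩
      have : m + ((n + (q - 1) * (m + 1)) + 1) = n + q * (m + 1) := by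
        obtain ⟨q, rfl⟩ := Nat.exists_eq_add_of_lt hq
        simp
        ring
      rw [← Nat.add_assoc, Nat.add_right_comm, Nat.add_mod_mod, Nat.add_right_comm, Nat.add_assoc,
        this, Nat.add_mul_mod_self_left]
    have hval : ‖φ (m + (i + 1))‖ = 1 := by
      have e1 := hp.map_mod_nat n
      have e2 := hp.map_mod_nat (m + (i + 1))
      simp only [hmod] at e1 e2
      rw [← e2, e1, hn]
    have := Finset.single_le_sum (f := fun i : Fin q => ‖φ (m + (i + 1))‖ ^ 2)
      (fun i _ => sq_nonneg _) (Finset.mem_univ ⟨i, hi⟩)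
    simp only [hval, one_pow] at this
    exact this
  refine exists_eigenvalue_near _ (u := fun i : Fin q => φ (m + (i + 1))) (by positivity)
    (by linarith) ?_
  refine le_trans ?_ (le_mul_of_one_le_right (by positivity) hsum)
  have hres (i : Fin q) : ‖(box ω (z * ω ^ m) q).mulVec (fun i => φ (m + (i + 1))) i -
      E * φ (m + (i + 1))‖ ^ 2 ≤
      (if (i : ℕ) = q - 1 then 2 * τ ^ 2 else 0) + if (i : ℕ) = 0 then 2 * τ ^ 2 else 0 := by
    rw [box_mulVec ω _ (fun j => φ (m + j))]
    have hd := hdef (m + i)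
    rw [defect, coef] at hd
    have e : ((2 * (z * ω ^ m * ω ^ (i : ℕ)).re : ℝ) : ℂ) * φ (m + (i + 1)) +
      (φ (m + (i + 2)) - if (i : ℕ) + 1 = q then φ (m + (i + 2)) else 0) +
        (φ (m + i) - if (i : ℕ) = 0 then φ (m + 0) else 0) - E * φ (m + (i + 1)) =
      -((if (i : ℕ) + 1 = q then φ (m + (i + 2)) else 0) +
        if (i : ℕ) = 0 then φ (m + 0) else 0) := by
      rw [mul_assoc, ← pow_add]
      push_cast at hd ⊢
      rw [show m + (i : ℕ) + 2 = m + (i + 2) by ring, show m + (i : ℕ) + 1 = m + (i + 1) by ring]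
        at hd
      linear_combination hd
    rw [e, norm_neg]
    have ha : ‖if (i : ℕ) + 1 = q then φ (m + (i + 2)) else 0‖ ≤
        if (i : ℕ) = q - 1 then τ else 0 := by
      by_cases h : (i : ℕ) + 1 = q
      · rw [if_pos h, if_pos (by omega), show m + ((i : ℕ) + 2) = m + 1 + q by omega, hper]
        exact h1
      · rw [if_neg h, if_neg (by omega), norm_zero]
    have hb : ‖if (i : ℕ) = 0 then φ (m + 0) else 0‖ ≤ if (i : ℕ) = 0 then τ else 0 := by
      by_cases h : (i : ℕ) = 0
      · rw [if_pos h, if_pos h]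
        exact h0
      · rw [if_neg h, if_neg h, norm_zero]
    refine (pow_le_pow_left₀ (norm_nonneg _)
      ((norm_add_le _ _).trans (add_le_add ha hb)) 2).trans ?_
    split_ifs <;> nlinarith [sq_nonneg τ]
  refine (Finset.sum_le_sum fun i _ => hres i).trans ?_
  rw [Finset.sum_add_distrib,
    Fin.sum_univ_eq_sum_range (fun i => if i = q - 1 then 2 * τ ^ 2 else 0),
    Fin.sum_univ_eq_sum_range (fun i => if i = 0 then 2 * τ ^ 2 else 0), Finset.sum_ite_eq',
    Finset.sum_ite_eq', if_pos (by simpa), if_pos (by simpa)]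
  linarith

theorem le_pow_of_convex {b : ℕ → ℝ} {ρ : ℝ} (hb : ∀ j, b j ≤ 1) (m k : ℕ)
    (hρ : 0 ≤ ρ) (h : ∀ j, m ≤ j + k → j ≤ m + k → b j ≤ ρ * max (b (j - 1)) (b (j + 1))) :
    b m ≤ ρ ^ (k + 1) := by
  have key (i : ℕ) (hi : i ≤ k + 1) :
      ∀ j, m + i ≤ j + (k + 1) → j + i ≤ m + (k + 1) → b j ≤ ρ ^ i := by
    induction i with
    | zero => exact fun j _ _ => by simpa using hb j
    | succ i ih =>
      intro j h1 h2
      refine (h j (by omega) (by omega)).trans ?_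
      rw [pow_succ']
      refine mul_le_mul_of_nonneg_left (max_le ?_ ?_) hρ
      · exact ih (by omega) _ (by omega) (by omega)
      · exact ih (by omega) _ (by omega) (by omega)
  exact key (k + 1) le_rfl m (by omega) (by omega)

theorem freq_add (a b : ℝ) : freq (a + b) = freq a * freq b := by
  rw [freq, freq, freq, ← Complex.exp_add]
  congr 1
  push_cast
  ring

theorem freq_natCast_mul (n : ℕ) (a : ℝ) : freq (n * a) = freq a ^ n := by
  rw [freq, freq, ← Complex.exp_nat_mul]
  congr 1
  push_cast
  ring

theorem dist_freq_le (a b : ℝ) : dist (freq a) (freq b) ≤ 2 * π * |a - b| := by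
  have h : freq a - freq b = freq b * (freq (a - b) - 1) := by
    rw [mul_sub, ← freq_add, add_sub_cancel, mul_one]
  rw [dist_eq_norm, h, norm_mul, norm_freq, one_mul, freq, mul_comm]
  refine Real.norm_exp_I_mul_ofReal_sub_one_le.trans_eq ?_
  rw [Real.norm_eq_abs, abs_mul, abs_of_pos Real.two_pi_pos]

theorem exists_dist_mul_freq_le {N : ℕ} (hN : 0 < N) {z c : ℂ} (hz : ‖z‖ = 1) (hc : ‖c‖ = 1) :
    ∃ m : ℕ, N ≤ m ∧ ∀ j : ℕ, dist (z * freq (1 / N) ^ j) c ≤ 2 * π * (|(j : ℝ) - m| + 1) / N := by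
  set t := Complex.arg (c / z) / (2 * π) with ht
  have hN' : (0 : ℝ) < N := by exact_mod_cast hN
  have hz0 : z ≠ 0 := by
    rintro rfl
    simp at hz
  have hfreq : freq (t + 2) = c / z := by
    have h1 : ‖c / z‖ = 1 := by rw [norm_div, hz, hc, div_one]
    have h2 := Complex.norm_mul_exp_arg_mul_I (c / z)
    rw [h1, Complex.ofReal_one, one_mul] at h2
    have h3 : freq t = c / z := by
      rw [freq, ht, mul_div_cancel₀ _ Real.two_pi_pos.ne', h2]
    have h4 : freq 2 = 1 := by
      rw [freq, ← Complex.exp_nat_mul_two_pi_mul_I 2]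
      congr 1
      push_cast
      ring
    rw [freq_add, h3, h4, mul_one]
  have ht1 : 1 ≤ t + 2 := by
    have := Complex.neg_pi_lt_arg (c / z)
    have : -1 ≤ t := by
      rw [ht, le_div_iff₀ Real.two_pi_pos]
      linarith [Real.pi_pos]
    linarith
  refine ⟨⌊N * (t + 2)⌋₊, Nat.le_floor (le_mul_of_one_le_right hN'.le ht1), fun j => ?_⟩
  have hfl := Nat.floor_le (mul_nonneg hN'.le (zero_le_one.trans ht1))
  have hlt := Nat.lt_floor_add_one (N * (t + 2))
  set m := ⌊N * (t + 2)⌋₊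
  have h1 : dist (z * freq (1 / N) ^ j) c = dist (freq (j * (1 / N))) (freq (t + 2)) := by
    rw [hfreq, freq_natCast_mul, dist_eq_norm, dist_eq_norm,
      show z * freq (1 / N) ^ j - c = z * (freq (1 / N) ^ j - c / z) by field_simp, norm_mul, hz,
      one_mul]
  rw [h1, mul_div_assoc]
  refine (dist_freq_le _ _).trans (mul_le_mul_of_nonneg_left ?_ Real.two_pi_pos.le)
  rw [le_div_iff₀ hN', ← abs_of_pos hN', ← abs_mul, abs_of_pos hN',
    show ((j : ℝ) * (1 / N) - (t + 2)) * N = (j - m) + (m - N * (t + 2)) by field_simp; ring]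
  refine (abs_add_le _ _).trans (add_le_add_right ?_ _)
  rw [abs_le]
  constructor <;> linarith

theorem norm_le_of_three_term {a b c : ℂ} {T κ e γ : ℝ} (hγ : 2 + γ + 2 * κ ≤ |T|)
    (h : ‖a + b - T * c‖ ≤ κ * e) : (2 + γ + 2 * κ) * ‖c‖ ≤ ‖a‖ + ‖b‖ + κ * e := by
  have e1 : (T : ℂ) * c = (a + b) - (a + b - T * c) := by ring
  have h1 := congrArg norm e1
  rw [norm_mul, Complex.norm_real, Real.norm_eq_abs] at h1
  have h2 := norm_sub_le (a + b) (a + b - T * c)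
  have h3 := norm_add_le a b
  have h4 := mul_le_mul_of_nonneg_right hγ (norm_nonneg c)
  linarith

/-- Near a resonance of the base frequency, an energy in a gap of the base operator is
exponentially close to an eigenvalue of a box. -/
theorem exists_exp_close_eigenvalue {μ₀ : ℝ} {p : ℕ} (hω₀ : IsPrimitiveRoot (freq μ₀) p)
    (hp : 0 < p) {δ : ℝ} (hδ : 0 < δ) :
    ∃ r > 0, ∀ N k : ℕ, 2 * π * (k + 2) < r * N → k < N → ∀ μ : ℝ, μ = μ₀ + 1 / (p * N) →
      IsPrimitiveRoot (freq μ) (p * N) → ∀ E, |E| ≤ 5 → |chambers (freq μ) (p * N) E| ≤ 4 →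
      δ ≤ |chambers (freq μ₀) p E| → ∃ w : ℂ, w ^ (2 * (p * N)) = 1 ∧
        ∃ i, |(box_isHermitian (freq μ) w (p * N)).eigenvalues i - E| ≤
          2 * (2 / (2 + 3 * δ / 8)) ^ (k + 1) := by
  obtain ⟨r, hr, H⟩ := exists_hyperbolic_radius hω₀ hp hδ
  refine ⟨r, hr, fun N k hk hkN μ hμ hω E hE hE4 hEδ => ?_⟩
  have hN : 0 < N := by omega
  have hN' : (0 : ℝ) < N := by exact_mod_cast hN
  have hp' : (1 : ℝ) ≤ p := by exact_mod_cast hp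
  have hpN : 0 < p * N := Nat.mul_pos hp hN
  obtain ⟨z, hz, hz2, φ, hdef, hper, hle, hone⟩ := exists_bloch_of_chambers hω hpN hE4
  obtain ⟨ε, hε, hεc⟩ : ∃ ε : ℝ, |ε| = 1 ∧ 2 + δ ≤ |chambers (freq μ₀) p E - 2 * ε| := by
    rcases le_abs'.1 hEδ with h | h
    · exact ⟨1, abs_one, le_abs'.2 (Or.inl (by linarith))⟩
    · exact ⟨-1, by simp, le_abs'.2 (Or.inr (by linarith))⟩
  obtain ⟨c, hc, hcp⟩ := exists_phase hp hε
  have hstep : freq μ ^ p = freq (1 / N) := by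
    rw [hμ, freq_add, mul_pow, hω₀.pow_eq_one, one_mul, ← freq_natCast_mul]
    congr 1
    field_simp
  have hnear : dist (freq μ) (freq μ₀) < r := by
    refine (dist_freq_le _ _).trans_lt ?_
    rw [hμ, add_sub_cancel_left, abs_of_nonneg (by positivity), mul_one_div,
      div_lt_iff₀ (by positivity)]
    have : r * N ≤ r * (p * N) := by
      gcongr
      exact le_mul_of_one_le_left hN'.le hp'
    refine lt_of_lt_of_le ?_ (hk.le.trans this)
    nlinarith [Real.pi_pos, Nat.cast_nonneg (α := ℝ) k]
  obtain ⟨m, hNm, hm⟩ := exists_dist_mul_freq_le hN hz hc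
  set b : ℕ → ℝ := fun j => max ‖φ (p * j)‖ ‖φ (p * j + 1)‖ with hb
  have hunit (j : ℕ) : ‖z * freq (1 / N) ^ j‖ = 1 := by
    rw [norm_mul, norm_pow, norm_freq, hz, one_pow, mul_one]
  have hclose (j : ℕ) (h1 : m ≤ j + (k + 1)) (h2 : j ≤ m + (k + 1)) :
      dist (z * freq (1 / N) ^ j) c < r := by
    refine (hm j).trans_lt ?_
    rw [div_lt_iff₀ hN']
    refine lt_of_le_of_lt ?_ hk
    have h1' : (m : ℝ) ≤ j + (k + 1) := by exact_mod_cast h1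
    have h2' : (j : ℝ) ≤ m + (k + 1) := by exact_mod_cast h2
    have : |(j : ℝ) - m| ≤ k + 1 := abs_le.2 ⟨by linarith, by linarith⟩
    exact mul_le_mul_of_nonneg_left (by linarith) Real.two_pi_pos.le
  have hdecay : b m ≤ (2 / (2 + 3 * δ / 8)) ^ (k + 1) := by
    refine le_pow_of_convex (b := b) (fun j => max_le (hle _) (hle _)) m k (by positivity)
      fun j h1 h2 => ?_
    obtain ⟨j, rfl⟩ : ∃ i, j = i + 1 := ⟨j - 1, by omega⟩
    rw [Nat.add_sub_cancel]
    obtain ⟨hT, hκ⟩ := H (freq μ) (z * freq (1 / N) ^ (j + 1)) (z * freq (1 / N) ^ j) c E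
      (norm_freq μ) (hunit _) (hunit _) hc hE hnear (hclose _ (by omega) (by omega))
      (hclose _ (by omega) (by omega)) (by rwa [hcp, Complex.ofReal_re])
    have h3 := three_term_le (x := coef (freq μ) (z * freq (1 / N) ^ j) E) (B := 7) (by norm_num)
      (abs_coef_le (norm_freq μ) (hunit j) hE) (fun i => φ (p * j + i)) p (κ := δ / 16)
      (by simpa only [coef_add, hstep, mul_assoc, ← pow_succ] using hκ)
    have hd (i : ℕ) : defect (coef (freq μ) (z * freq (1 / N) ^ j) E) (fun i => φ (p * j + i)) i =
        0 := by
      have := hdef (p * j + i)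
      rw [defect, add_comm (p * j) i, coef_add, pow_mul, hstep] at this
      rw [defect]
      simp only [← add_assoc, add_comm (p * j) i]
      exact this
    simp only [hd, norm_zero, Finset.sum_const_zero, mul_zero, add_zero, coef_add, hstep,
      mul_assoc, ← pow_succ] at h3
    rw [show p * j + (2 * p + 1) = p * (j + 1 + 1) + 1 by ring,
      show p * j + (2 * p) = p * (j + 1 + 1) by ring,
      show p * j + (p + 1) = p * (j + 1) + 1 by ring,
      show p * j + p = p * (j + 1) by ring] at h3
    have hκ0 : (0 : ℝ) ≤ δ / 16 := by positivity
    have hT' : 2 + 3 * δ / 8 + 2 * (δ / 16) ≤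
        |(transfer 1 (coef (freq μ) (z * freq (1 / N) ^ (j + 1)) E) p).trace| := by linarith
    have h4 := norm_le_of_three_term hT' h3.1
    have h5 := norm_le_of_three_term hT' h3.2
    have l1 (j : ℕ) : ‖φ (p * j)‖ ≤ b j := le_max_left _ _
    have l2 (j : ℕ) : ‖φ (p * j + 1)‖ ≤ b j := le_max_right _ _
    have h6 : δ / 16 * (‖φ (p * (j + 1) + 1)‖ + ‖φ (p * (j + 1))‖) ≤ δ / 16 * (2 * b (j + 1)) :=
      mul_le_mul_of_nonneg_left (by linarith [l1 (j + 1), l2 (j + 1)]) hκ0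
    have h7 : (2 + 3 * δ / 8 + 2 * (δ / 16)) * b (j + 1) ≤
        b (j + 1 + 1) + b j + δ / 16 * (2 * b (j + 1)) := by
      rcases max_choice ‖φ (p * (j + 1))‖ ‖φ (p * (j + 1) + 1)‖ with h | h
      · rw [show b (j + 1) = ‖φ (p * (j + 1))‖ from h] at h6 ⊢
        linarith [l1 (j + 1 + 1), l1 j]
      · rw [show b (j + 1) = ‖φ (p * (j + 1) + 1)‖ from h] at h6 ⊢
        linarith [l2 (j + 1 + 1), l2 j]
    rw [div_mul_eq_mul_div, le_div_iff₀ (by positivity)]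
    linarith [le_max_left (b j) (b (j + 1 + 1)), le_max_right (b j) (b (j + 1 + 1))]
  refine ⟨z * freq μ ^ (p * m), ?_, exists_box_eigenvalue hpN hdef hper hone
    ((le_max_left _ _).trans hdecay) ((le_max_right _ _).trans hdecay)⟩
  rw [mul_pow, hz2, one_mul, ← pow_mul,
    show p * m * (2 * (p * N)) = p * N * (2 * p * m) by ring, pow_mul, hω.pow_eq_one, one_pow]

/-- `A` is covered by finitely many open balls with total `s`-dimensional size at most `ε`. -/
def HasCover (s ε : ℝ) (A : Set ℝ) : Prop :=
  ∃ C : Finset (ℝ × ℝ), (∀ p ∈ C, 0 < p.2) ∧ (A ⊆ ⋃ p ∈ C, Metric.ball p.1 p.2) ∧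
    ∑ p ∈ C, (2 * p.2) ^ s ≤ ε

theorem HasCover.mono {s ε : ℝ} {A B : Set ℝ} (h : HasCover s ε B) (hAB : A ⊆ B) :
    HasCover s ε A := by
  obtain ⟨C, h1, h2, h3⟩ := h
  exact ⟨C, h1, hAB.trans h2, h3⟩

theorem HasCover.union {s ε ε' : ℝ} {A B : Set ℝ} (hA : HasCover s ε A) (hB : HasCover s ε' B) :
    HasCover s (ε + ε') (A ∪ B) := by
  classical
  obtain ⟨C, h1, h2, h3⟩ := hA
  obtain ⟨C', h1', h2', h3'⟩ := hB
  refine ⟨C ∪ C', fun p hp => ?_, ?_, ?_⟩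
  · rcases Finset.mem_union.1 hp with h | h
    exacts [h1 p h, h1' p h]
  · rw [Finset.set_biUnion_union]
    exact Set.union_subset_union h2 h2'
  · rw [← Finset.union_sdiff_self_eq_union, Finset.sum_union Finset.disjoint_sdiff]
    refine add_le_add h3 (le_trans ?_ h3')
    refine Finset.sum_le_sum_of_subset_of_nonneg Finset.sdiff_subset fun p hp _ => ?_
    exact Real.rpow_nonneg (mul_nonneg zero_le_two (h1' p hp).le) s

theorem hasCover_of_card_mul_le {s ε R : ℝ} {A : Set ℝ} (S : Finset ℝ) (hR : 0 < R)
    (hA : ∀ x ∈ A, ∃ c ∈ S, |c - x| < R) (hS : S.card * (2 * R) ^ s ≤ ε) : HasCover s ε A := by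
  classical
  refine ⟨S.image fun c => (c, R), fun p hp => ?_, fun x hx => ?_, ?_⟩
  · obtain ⟨c, -, rfl⟩ := Finset.mem_image.1 hp
    exact hR
  · obtain ⟨c, hc, hcx⟩ := hA x hx
    refine Set.mem_iUnion₂.2 ⟨(c, R), Finset.mem_image_of_mem _ hc, ?_⟩
    rwa [Metric.mem_ball, dist_comm, Real.dist_eq]
  · rw [Finset.sum_image fun a _ b _ h => (Prod.ext_iff.1 h).1]
    simpa only [Finset.sum_const, nsmul_eq_mul] using hS

theorem HasCover.exists_isOpen {s ε : ℝ} {A : Set ℝ} (h : HasCover s ε A) :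
    ∃ O, IsOpen O ∧ A ⊆ O ∧ HasCover s ε O := by
  obtain ⟨C, h1, h2, h3⟩ := h
  exact ⟨_, isOpen_biUnion fun p _ => Metric.isOpen_ball, h2, C, h1, subset_rfl, h3⟩

theorem dimH_eq_zero_of_hasCover {A : Set ℝ}
    (h : ∀ k : ℕ, HasCover (1 / (k + 1)) (1 / (k + 1)) A) : dimH A = 0 := by
  choose C hpos hsub hsum using h
  have hterm (k : ℕ) {p} (hp : p ∈ C k) : (2 * p.2) ^ (1 / (k + 1) : ℝ) ≤ 1 / (k + 1) :=
    (Finset.single_le_sum (f := fun p : ℝ × ℝ => (2 * p.2) ^ (1 / (k + 1) : ℝ)) (fun p hp =>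
      Real.rpow_nonneg (mul_nonneg zero_le_two (hpos k p hp).le) _) hp).trans (hsum k)
  have hk1 (k : ℕ) : (1 / (k + 1) : ℝ) ≤ 1 := by
    rw [div_le_one (by positivity)]
    linarith [Nat.cast_nonneg (α := ℝ) k]
  have hrad (k : ℕ) {p} (hp : p ∈ C k) : 2 * p.2 ≤ 1 / (k + 1) := by
    have h2 : 0 ≤ 2 * p.2 := mul_nonneg zero_le_two (hpos k p hp).le
    have hle1 : 2 * p.2 ≤ 1 := by
      by_contra! hlt
      have := Real.one_lt_rpow hlt (show (0 : ℝ) < 1 / (k + 1) by positivity)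
      linarith [hterm k hp, hk1 k]
    calc 2 * p.2 = (2 * p.2) ^ (1 : ℝ) := (Real.rpow_one _).symm
      _ ≤ (2 * p.2) ^ (1 / (k + 1) : ℝ) :=
        Real.rpow_le_rpow_of_exponent_ge (mul_pos two_pos (hpos k p hp)) hle1 (hk1 k)
      _ ≤ _ := hterm k hp
  have hdiam (p : ℝ × ℝ) : Metric.ediam (Metric.ball p.1 p.2) = ENNReal.ofReal (2 * p.2) := by
    rw [Real.ball_eq_Ioo, Real.ediam_Ioo]
    congr 1
    ring
  have hlim : Filter.Tendsto (fun k : ℕ => ENNReal.ofReal (1 / (k + 1))) Filter.atTop (nhds 0) := by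
    simpa using ENNReal.tendsto_ofReal (tendsto_one_div_add_atTop_nhds_zero_nat (𝕜 := ℝ))
  by_contra hne
  obtain ⟨d, hd0, hd⟩ := ENNReal.lt_iff_exists_nnreal_btwn.1 (pos_iff_ne_zero.2 hne)
  have hd0' : (0 : ℝ) < d := by exact_mod_cast hd0
  refine hd.not_ge (dimH_le_of_hausdorffMeasure_ne_top (ne_top_of_le_ne_top ENNReal.one_ne_top ?_))
  refine (Measure.hausdorffMeasure_le_liminf_sum (ι := fun k => C k) d A (l := Filter.atTop) _ hlim
    (fun k p => Metric.ball p.1.1 p.1.2) (.of_forall fun k p => ?_)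
    (.of_forall fun k => ?_)).trans ?_
  · rw [hdiam]
    exact ENNReal.ofReal_le_ofReal (hrad k p.2)
  · refine (hsub k).trans ?_
    rw [Set.iUnion_subtype]
  · refine Filter.liminf_le_of_frequently_le' (Filter.Eventually.frequently ?_)
    filter_upwards [tendsto_one_div_add_atTop_nhds_zero_nat.eventually (Iic_mem_nhds hd0')]
      with k hk
    calc ∑ p : C k, Metric.ediam (Metric.ball p.1.1 p.1.2) ^ (d : ℝ)
        ≤ ∑ p : C k, ENNReal.ofReal ((2 * p.1.2) ^ (1 / (k + 1) : ℝ)) := by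
          refine Finset.sum_le_sum fun p _ => ?_
          have hp := mul_pos two_pos (hpos k p p.2)
          rw [hdiam, ENNReal.ofReal_rpow_of_nonneg hp.le hd0'.le]
          exact ENNReal.ofReal_le_ofReal (Real.rpow_le_rpow_of_exponent_ge hp
            ((hrad k p.2).trans (hk1 k)) hk)
      _ = ∑ p ∈ C k, ENNReal.ofReal ((2 * p.2) ^ (1 / (k + 1) : ℝ)) :=
          Finset.sum_coe_sort (C k) fun p : ℝ × ℝ => ENNReal.ofReal ((2 * p.2) ^ (1 / (k + 1) : ℝ))
      _ = ENNReal.ofReal (∑ p ∈ C k, (2 * p.2) ^ (1 / (k + 1) : ℝ)) :=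
          (ENNReal.ofReal_sum_of_nonneg fun p hp =>
            Real.rpow_nonneg (mul_nonneg zero_le_two (hpos k p hp).le) _).symm
      _ ≤ 1 := ENNReal.ofReal_le_one.2 ((hsum k).trans (hk1 k))

theorem exists_le_of_isCompact {K : Set ℝ} (hK : IsCompact K) {f : ℝ → ℝ} (hf : Continuous f)
    {a : ℝ} (h : ∀ x ∈ K, a < f x) : ∃ δ > 0, ∀ x ∈ K, a + δ ≤ f x := by
  rcases K.eq_empty_or_nonempty with rfl | hne
  · exact ⟨1, one_pos, by simp⟩
  · obtain ⟨x, hx, hmin⟩ := hK.exists_isMinOn hne hf.continuousOn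
    exact ⟨f x - a, sub_pos.2 (h x hx), fun y hy => by
      rw [add_sub_cancel]
      exact hmin hy⟩

theorem eventually_hasCover_approxSpectrum {μ₀ : ℝ} {q : ℕ} (hω₀ : IsPrimitiveRoot (freq μ₀) q)
    (hq : 0 < q) {s ε : ℝ} (h : HasCover s ε {E | |E| ≤ 5 ∧ |chambers (freq μ₀) q E| ≤ 4}) :
    ∀ᶠ μ in nhds μ₀, HasCover s ε (approxSpectrum μ) := by
  obtain ⟨O, hO, hsub, hcov⟩ := h.exists_isOpen
  obtain ⟨δ, hδ, hle⟩ := exists_le_of_isCompact ((isCompact_Icc (a := (-5 : ℝ)) (b := 5)).diff hO)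
    (continuous_chambers (freq μ₀) q).abs (a := 4) fun E hE => by
      by_contra! hlt
      exact hE.2 (hsub ⟨abs_le.2 hE.1, hlt⟩)
  filter_upwards [abs_chambers_lt_of_approxSpectrum hω₀ hq hδ] with μ hμ
  refine hcov.mono fun E hE => ?_
  by_contra hEO
  exact (hμ E hE).not_ge (hle E ⟨abs_le.1 (abs_le_five hE), hEO⟩)

theorem eventually_hasCover_zero {ω : ℂ} {q : ℕ} (hω : IsPrimitiveRoot ω q) (hq : 0 < q)
    {s ε : ℝ} (hs : 0 < s) (hε : 0 < ε) :
    ∃ δ > 0, HasCover s ε {E | |E| ≤ 5 ∧ |chambers ω q E| < δ} := by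
  set Z := (finite_chambers_eq_zero hω hq).toFinset with hZ
  have hlim : Filter.Tendsto (fun R : ℝ => Z.card * (2 * R) ^ s) (nhdsWithin 0 (Set.Ioi 0))
      (nhds 0) := by
    have : Filter.Tendsto (fun R : ℝ => Z.card * (2 * R) ^ s) (nhds 0)
        (nhds (Z.card * (2 * 0) ^ s)) :=
      ((Real.continuous_rpow_const hs.le).comp (continuous_const.mul continuous_id)).tendsto 0
        |>.const_mul _
    rw [mul_zero, Real.zero_rpow hs.ne', mul_zero] at this
    exact this.mono_left nhdsWithin_le_nhds
  obtain ⟨R, hRε, hR⟩ := ((hlim.eventually (Iic_mem_nhds hε)).and self_mem_nhdsWithin).exists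
  have hcov : HasCover s ε {E | chambers ω q E = 0} :=
    hasCover_of_card_mul_le Z hR (fun x hx => ⟨x, by simpa [hZ] using hx, by simpa using hR⟩) hRε
  obtain ⟨O, hO, hsub, hcovO⟩ := hcov.exists_isOpen
  obtain ⟨δ, hδ, hle⟩ := exists_le_of_isCompact ((isCompact_Icc (a := (-5 : ℝ)) (b := 5)).diff hO)
    (continuous_chambers ω q).abs (a := 0) fun E hE => abs_pos.2 fun h0 => hE.2 (hsub h0)
  refine ⟨δ, hδ, hcovO.mono fun E hE => ?_⟩
  by_contra hEO
  have := hle E ⟨abs_le.1 hE.1, hEO⟩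
  rw [zero_add] at this
  exact hE.2.not_ge this

theorem hasCover_box {ω : ℂ} {q : ℕ} (hq : 0 < q) {s R : ℝ} (hR : 0 < R) {A : Set ℝ}
    (hA : ∀ E ∈ A, ∃ w : ℂ, w ^ (2 * q) = 1 ∧
      ∃ i, |(box_isHermitian ω w q).eigenvalues i - E| < R) :
    HasCover s (2 * q ^ 2 * (2 * R) ^ s) A := by
  classical
  have h2q : 0 < 2 * q := by omega
  set S := (Polynomial.nthRootsFinset (2 * q) (1 : ℂ)).biUnion fun w =>
    Finset.univ.image (box_isHermitian ω w q).eigenvalues with hS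
  have hcard : S.card ≤ 2 * q * q := by
    refine (Finset.card_biUnion_le_card_mul _ _ q fun w _ => ?_).trans (Nat.mul_le_mul_right q ?_)
    · exact Finset.card_image_le.trans_eq (by simp)
    · rw [Polynomial.nthRootsFinset]
      convert (Multiset.toFinset_card_le _).trans (Polynomial.card_nthRoots (2 * q) (1 : ℂ))
  refine hasCover_of_card_mul_le S hR (fun E hE => ?_) ?_
  · obtain ⟨w, hw, i, hi⟩ := hA E hE
    refine ⟨_, ?_, hi⟩
    rw [hS, Finset.mem_biUnion]
    exact ⟨w, (Polynomial.mem_nthRootsFinset h2q 1).2 hw,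
      Finset.mem_image_of_mem _ (Finset.mem_univ i)⟩
  · refine mul_le_mul_of_nonneg_right ?_ (Real.rpow_nonneg (by positivity) _)
    calc (S.card : ℝ) ≤ (2 * q * q : ℕ) := by exact_mod_cast hcard
      _ = 2 * q ^ 2 := by push_cast; ring

theorem tendsto_sq_mul_exp_rpow {p : ℝ} {ρ c s : ℝ} (hρ : 0 < ρ) (hρ1 : ρ < 1) (hc : 0 < c)
    (hs : 0 < s) :
    Filter.Tendsto (fun N : ℕ => 2 * (p * N) ^ 2 * (2 * (3 * ρ ^ (⌊c * N⌋₊ + 1))) ^ s)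
      Filter.atTop (nhds 0) := by
  have hx1 : |ρ ^ (c * s)| < 1 := by
    rw [abs_of_nonneg (Real.rpow_nonneg hρ.le _)]
    exact Real.rpow_lt_one hρ.le hρ1 (mul_pos hc hs)
  have hlim := (tendsto_pow_const_mul_const_pow_of_abs_lt_one 2 hx1).const_mul (2 * p ^ 2 * 6 ^ s)
  rw [mul_zero] at hlim
  refine squeeze_zero (fun N => by positivity) (fun N => ?_) hlim
  have h1 : ρ ^ (⌊c * N⌋₊ + 1) ≤ ρ ^ (c * N) := by
    rw [← Real.rpow_natCast]
    refine Real.rpow_le_rpow_of_exponent_ge hρ hρ1.le ?_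
    push_cast
    exact (Nat.lt_floor_add_one _).le
  calc 2 * (p * N) ^ 2 * (2 * (3 * ρ ^ (⌊c * N⌋₊ + 1))) ^ s
      ≤ 2 * (p * N) ^ 2 * (6 * ρ ^ (c * N)) ^ s := by
        refine mul_le_mul_of_nonneg_left ?_ (by positivity)
        exact Real.rpow_le_rpow (by positivity) (by linarith) hs.le
    _ = 2 * p ^ 2 * 6 ^ s * (N ^ 2 * (ρ ^ (c * s)) ^ N) := by
        rw [Real.mul_rpow (by norm_num) (Real.rpow_nonneg hρ.le _), ← Real.rpow_mul hρ.le,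
          ← Real.rpow_natCast (ρ ^ (c * s)), ← Real.rpow_mul hρ.le,
          show c * N * s = c * s * N by ring]
        ring

theorem eventually_hasCover_chambers {μ₀ : ℝ} {p : ℕ} (hω₀ : IsPrimitiveRoot (freq μ₀) p)
    (hp : 0 < p) {s ε : ℝ} (hs : 0 < s) (hε : 0 < ε) :
    ∀ᶠ N : ℕ in Filter.atTop, ∀ μ : ℝ, μ = μ₀ + 1 / (p * N) → IsPrimitiveRoot (freq μ) (p * N) →
      HasCover s ε {E | |E| ≤ 5 ∧ |chambers (freq μ) (p * N) E| ≤ 4} := by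
  obtain ⟨δ, hδ, hcov⟩ := eventually_hasCover_zero hω₀ hp hs (half_pos hε)
  obtain ⟨r, hr, H⟩ := exists_exp_close_eigenvalue hω₀ hp hδ
  set c := min (r / (4 * π)) (1 / 2) with hc
  have hc0 : 0 < c := lt_min (by positivity) (by norm_num)
  set ρ := 2 / (2 + 3 * δ / 8)
  have hρ : 0 < ρ := by positivity
  have hρ1 : ρ < 1 := by
    rw [div_lt_one (by positivity)]
    linarith
  filter_upwards [(tendsto_sq_mul_exp_rpow (p := p) hρ hρ1 hc0 hs).eventually
      (Iic_mem_nhds (half_pos hε)), Filter.eventually_gt_atTop 0,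
    (tendsto_natCast_atTop_atTop (R := ℝ)).eventually_gt_atTop (8 * π / r)] with N h1 hN hNr μ hμ hω
  have hN' : (0 : ℝ) < N := by exact_mod_cast hN
  have hfl := Nat.floor_le (mul_nonneg hc0.le hN'.le)
  have hk : 2 * π * (⌊c * N⌋₊ + 2) < r * N := by
    have e1 : c * N ≤ r / (4 * π) * N := mul_le_mul_of_nonneg_right (min_le_left _ _) hN'.le
    have e2 := mul_le_mul_of_nonneg_left (hfl.trans e1) Real.two_pi_pos.le
    have e3 : 2 * π * (r / (4 * π) * N) = r * N / 2 := by field_simp; ring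
    rw [div_lt_iff₀ hr] at hNr
    linarith
  have hkN : ⌊c * N⌋₊ < N := by
    have e1 : c * N ≤ 1 / 2 * N := mul_le_mul_of_nonneg_right (min_le_right _ _) hN'.le
    have : (⌊c * N⌋₊ : ℝ) < N := by linarith
    exact_mod_cast this
  have hR : 0 < 3 * ρ ^ (⌊c * N⌋₊ + 1) := by positivity
  have hbox : HasCover s (2 * (p * N : ℕ) ^ 2 * (2 * (3 * ρ ^ (⌊c * N⌋₊ + 1))) ^ s)
      {E | (|E| ≤ 5 ∧ |chambers (freq μ) (p * N) E| ≤ 4) ∧ δ ≤ |chambers (freq μ₀) p E|} := by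
    refine hasCover_box (ω := freq μ) (Nat.mul_pos hp hN) hR fun E hE => ?_
    obtain ⟨w, hw, i, hi⟩ := H N _ hk hkN μ hμ hω E hE.1.1 hE.1.2 hE.2
    refine ⟨w, hw, i, hi.trans_lt ?_⟩
    have : 0 < ρ ^ (⌊c * N⌋₊ + 1) := by positivity
    linarith
  obtain ⟨C, C1, C2, C3⟩ := hcov.union hbox
  refine ⟨C, C1, fun E hE => C2 ?_, C3.trans ?_⟩
  · rcases lt_or_ge |chambers (freq μ₀) p E| δ with h | h
    · exact Or.inl ⟨hE.1, h⟩
    · exact Or.inr ⟨hE, h⟩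
  · have : 2 * ((p : ℝ) * N) ^ 2 * (2 * (3 * ρ ^ (⌊c * N⌋₊ + 1))) ^ s ≤ ε / 2 := h1
    push_cast
    linarith

theorem isPrimitiveRoot_freq (x : ℚ) : IsPrimitiveRoot (freq x) x.den := by
  have := Complex.isPrimitiveRoot_exp_rat x
  rw [freq]
  convert this using 2
  push_cast
  ring

theorem isPrimitiveRoot_freq_add (x : ℚ) {M : ℕ} (hM : 0 < M) :
    IsPrimitiveRoot (freq (x + 1 / (x.den * (x.den * M : ℕ)))) (x.den * (x.den * M)) := by
  have hd : (0 : ℤ) < x.den * (x.den * M) := by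
    have := x.den_pos
    positivity
  have hcop : Nat.Coprime (x.num * (x.den * M) + 1 : ℤ).natAbs
      ((x.den : ℤ) * (x.den * M)).natAbs := by
    rw [← Int.isCoprime_iff_nat_coprime]
    have h1 : IsCoprime (x.num * (x.den * M) + 1 : ℤ) (x.den * M) := ⟨1, -x.num, by ring⟩
    exact h1.of_mul_right_left.mul_right h1
  have hden := Rat.den_div_eq_of_coprime hd hcop
  set y : ℚ := ((x.num * (x.den * M) + 1 : ℤ) : ℚ) / ((x.den * (x.den * M) : ℤ) : ℚ) with hy
  have hyd : y.den = x.den * (x.den * M) := by exact_mod_cast hden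
  have hM' : (M : ℝ) ≠ 0 := by exact_mod_cast hM.ne'
  have hxd : (x.den : ℝ) ≠ 0 := by exact_mod_cast x.den_ne_zero
  have hyv : (y : ℝ) = x + 1 / (x.den * (x.den * M : ℕ)) := by
    have hx : (x : ℝ) = x.num / x.den := Rat.cast_def x
    rw [hx, hy]
    push_cast
    field_simp
  rw [← hyd, ← hyv]
  exact isPrimitiveRoot_freq y

theorem dense_interior_hasCover {s ε : ℝ} (hs : 0 < s) (hε : 0 < ε) :
    Dense (interior {μ | HasCover s ε (approxSpectrum μ)}) := by
  refine dense_closure.1 (Dense.mono ?_ (Rat.denseRange_cast (𝕜 := ℝ)))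
  rintro _ ⟨x, rfl⟩
  have hden : (0 : ℝ) < x.den := by exact_mod_cast x.den_pos
  have hN : Filter.Tendsto (fun M : ℕ => x.den * M) Filter.atTop Filter.atTop :=
    Filter.tendsto_id.const_mul_atTop' x.den_pos
  have hlim : Filter.Tendsto (fun M : ℕ => (x : ℝ) + 1 / (x.den * (x.den * M : ℕ))) Filter.atTop
      (nhds x) := by
    have h1 := ((tendsto_natCast_atTop_atTop (R := ℝ)).comp hN).const_mul_atTop hden
    have h2 := (tendsto_inv_atTop_zero.comp h1).const_add (x : ℝ)
    rw [add_zero] at h2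
    simp only [one_div]
    exact h2
  refine mem_closure_of_tendsto hlim ?_
  filter_upwards [hN.eventually
      (eventually_hasCover_chambers (isPrimitiveRoot_freq x) x.den_pos hs hε),
    Filter.eventually_gt_atTop 0] with M hM hM0
  rw [mem_interior_iff_mem_nhds]
  exact eventually_hasCover_approxSpectrum (isPrimitiveRoot_freq_add x hM0)
    (Nat.mul_pos x.den_pos (Nat.mul_pos x.den_pos hM0)) (hM _ rfl (isPrimitiveRoot_freq_add x hM0))

end AlmostMathieu

/-- There is a dense `Gδ` set `M ⊆ ℝ` of frequencies such that for every
`μ ∈ M` and every phase `θ`, the spectrum of the critical almost Mathieu operator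
`H_{μ,θ}`, viewed as a subset of `ℝ`, has Hausdorff dimension zero. -/
theorem exists_dense_Gdelta_hausdorff_dim_zero :
    ∃ M : Set ℝ, Dense M ∧ IsGδ M ∧
      ∀ μ ∈ M, ∀ θ : ℝ,
        ∀ H : lp (fun _ : ℤ => ℂ) 2 →L[ℂ] lp (fun _ : ℤ => ℂ) 2,
          (∀ (u : lp (fun _ : ℤ => ℂ) 2) (n : ℤ),
            H u n = u (n + 1) + u (n - 1)
              + ((2 * Real.cos (2 * π * μ * n + θ) : ℝ) : ℂ) * u n) →
          dimH (Complex.ofReal ⁻¹' spectrum ℂ H) = 0 := by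
  let U (k : ℕ) : Set ℝ :=
    interior {μ | AlmostMathieu.HasCover (1 / (k + 1)) (1 / (k + 1))
      (AlmostMathieu.approxSpectrum μ)}
  have hU (k : ℕ) : IsOpen (U k) := isOpen_interior
  refine ⟨⋂ k, U k, dense_iInter_of_isOpen hU fun k =>
    AlmostMathieu.dense_interior_hasCover (by positivity) (by positivity),
    .iInter_of_isOpen hU, fun μ hμ θ H hH => AlmostMathieu.dimH_eq_zero_of_hasCover fun k => ?_⟩
  exact (interior_subset (Set.mem_iInter.1 hμ k)).mono fun E hE =>
    AlmostMathieu.mem_approxSpectrum hH hE
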